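/- arXiv:1206.5402 — 4 statements merged into one kernel-verified Lean document; each statement's English description precedes it below -/
import Mathlib

section
/- Let m be a positive integer, l an odd positive integer, and a an integer with 0 ≤ a < m. Define ω_a: (Z_m)^l → k^* on the cyclic group Z_m = ⟨g | g^m = 1⟩ by ω_a(g^{i_1}, …, g^{i_l}) = ζ_m^{a · i_1 · [(i_2+i_3)/m] · [(i_4+i_5)/m] ⋯ [(i_{l−1}+i_l)/m]} for 0 ≤ i_1, …, i_l < m (for l = 1 the empty product of floor factors is understood to be 1). Then ω_a is an l-cocycle on Z_m with values in k^*. -/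
open scoped BigOperators

/-- The coboundary of an `l`-cochain `ω : G^l → kˣ` on an (additively written) group `G`
with values in `kˣ` (trivial action):
`δω(x₁,…,x_{l+1}) = ω(x₂,…,x_{l+1}) · ∏_{j=1}^{l} ω(x₁,…,x_j x_{j+1},…,x_{l+1})^{(−1)^j}
  · ω(x₁,…,x_l)^{(−1)^{l+1}}`. -/
noncomputable def dCochain {G : Type*} [AddGroup G] {k : Type*} [Field k] {l : ℕ}
    (ω : (Fin l → G) → kˣ) : (Fin (l + 1) → G) → kˣ := fun x =>
  ω (fun i => x i.succ) *
    (∏ j : Fin l, ω (fun i : Fin l =>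
        if (i : ℕ) < (j : ℕ) then x i.castSucc
        else if (i : ℕ) = (j : ℕ) then x i.castSucc + x i.succ
        else x i.succ) ^ ((-1 : ℤ) ^ ((j : ℕ) + 1))) *
    ω (fun i => x i.castSucc) ^ ((-1 : ℤ) ^ (l + 1))

/-- An `l`-cochain is an `l`-cocycle if its coboundary is identically `1`. -/
def IsCocycle {G : Type*} [AddGroup G] {k : Type*} [Field k] {l : ℕ}
    (ω : (Fin l → G) → kˣ) : Prop :=
  ∀ x : Fin (l + 1) → G, dCochain ω x = 1

/-- The carry 2-cocycle. -/
def carry (m : ℕ) (u v : ZMod m) : ZMod m := (((u.val + v.val) / m : ℕ) : ZMod m)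

theorem carry_cocycle (m : ℕ) (hm : 0 < m) (u v w : ZMod m) :
    carry m v w + carry m u (v + w) = carry m (u + v) w + carry m u v := by
  have : NeZero m := ⟨hm.ne'⟩
  unfold carry
  norm_cast
  congr 1
  apply Nat.eq_of_mul_eq_mul_left hm
  have h1 := Nat.div_add_mod (v.val + w.val) m
  have h2 := Nat.div_add_mod (u.val + v.val) m
  have h3 := Nat.div_add_mod (u.val + (v + w).val) m
  have h4 := Nat.div_add_mod ((u + v).val + w.val) m
  rw [← ZMod.val_add] at h1 h2 h3 h4
  rw [add_assoc] at h4
  rw [Nat.mul_add, Nat.mul_add]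
  omega

/-- The exponent, as an element of `ZMod m`. -/
def expo (m n : ℕ) (y : ℕ → ZMod m) : ZMod m :=
  y 0 * ∏ t ∈ Finset.range n, carry m (y (2 * t + 1)) (y (2 * t + 2))

/-- Inner face maps. -/
def face (m j : ℕ) (y : ℕ → ZMod m) : ℕ → ZMod m := fun i =>
  if i < j then y i else if i = j then y i + y (i + 1) else y (i + 1)

theorem expo_succ (m n : ℕ) (y : ℕ → ZMod m) :
    expo m (n + 1) y = expo m n y * carry m (y (2 * n + 1)) (y (2 * n + 2)) := by
  simp [expo, Finset.prod_range_succ, mul_assoc]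

theorem expo_congr (m n : ℕ) (y z : ℕ → ZMod m) (h : ∀ i < 2 * n + 1, y i = z i) :
    expo m n y = expo m n z := by
  unfold expo
  rw [h 0 (by omega)]
  congr 1
  apply Finset.prod_congr rfl
  intro t ht
  have := Finset.mem_range.1 ht
  rw [h _ (by omega), h _ (by omega)]

theorem expo_sum (m n : ℕ) (hm : 0 < m) (y : ℕ → ZMod m) :
    expo m n (fun i => y (i + 1)) +
      (∑ j ∈ Finset.range (2 * n + 1), (-1) ^ (j + 1) * expo m n (face m j y)) +
      expo m n y = 0 := by
  induction n with
  | zero => simp [expo, face]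
  | succ n ih =>
    have e : 2 * (n + 1) + 1 = 2 * n + 1 + 1 + 1 := by ring
    rw [e, Finset.sum_range_succ, Finset.sum_range_succ]
    have h1 : ∀ j ∈ Finset.range (2 * n + 1),
        (-1) ^ (j + 1) * expo m (n + 1) (face m j y) =
        ((-1) ^ (j + 1) * expo m n (face m j y)) * carry m (y (2 * n + 2)) (y (2 * n + 3)) := by
      intro j hj
      have := Finset.mem_range.1 hj
      rw [expo_succ, mul_assoc]
      congr 3
      · unfold face
        rw [if_neg (by omega), if_neg (by omega)]
      · unfold face
        rw [if_neg (by omega), if_neg (by omega)]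
    rw [Finset.sum_congr rfl h1, ← Finset.sum_mul]
    have h2 : expo m (n + 1) (face m (2 * n + 1) y) =
        expo m n y * carry m (y (2 * n + 1) + y (2 * n + 2)) (y (2 * n + 3)) := by
      rw [expo_succ, expo_congr m n (face m (2 * n + 1) y) y]
      · simp [face]
      · intro i hi
        simp [face, hi]
    have h3 : expo m (n + 1) (face m (2 * n + 1 + 1) y) =
        expo m n y * carry m (y (2 * n + 1)) (y (2 * n + 2) + y (2 * n + 3)) := by
      rw [expo_succ, expo_congr m n (face m (2 * n + 1 + 1) y) y]
      · simp [face]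
      · intro i hi
        unfold face
        rw [if_pos (by omega)]
    rw [h2, h3, expo_succ, expo_succ]
    have s1 : (-1 : ZMod m) ^ (2 * n + 1 + 1) = 1 := Even.neg_one_pow ⟨n + 1, by ring⟩
    have s2 : (-1 : ZMod m) ^ (2 * n + 1 + 1 + 1) = -1 := by rw [pow_succ, s1]; ring
    rw [s1, s2]
    have hc := carry_cocycle m hm (y (2 * n + 1)) (y (2 * n + 2)) (y (2 * n + 3))
    linear_combination carry m (y (2 * n + 2)) (y (2 * n + 3)) * ih - expo m n y * hc

theorem expo_bridge (m n : ℕ) (hm : 0 < m) (a : ℕ) (z : Fin (2 * n + 1) → ZMod m)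
    (y : ℕ → ZMod m) (h : ∀ i : Fin (2 * n + 1), z i = y i) :
    ((a * (z ⟨0, by omega⟩).val *
        ∏ t : Fin ((2 * n + 1 - 1) / 2),
          ((z ⟨2 * (t : ℕ) + 1, by have := t.isLt; omega⟩).val +
            (z ⟨2 * (t : ℕ) + 2, by have := t.isLt; omega⟩).val) / m : ℕ) : ZMod m) =
      a * expo m n y := by
  have : NeZero m := ⟨hm.ne'⟩
  simp only [h]
  rw [Fin.prod_univ_eq_prod_range (fun t => ((y (2 * t + 1)).val + (y (2 * t + 2)).val) / m)]
  have e : (2 * n + 1 - 1) / 2 = n := by omega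
  rw [e]
  push_cast
  simp [expo, carry, mul_assoc]

/-- For `m > 0`, `l` odd, `ζ_m` a primitive `m`-th root of unity and
`0 ≤ a < m`, the map
`ω_a(g^{i₁},…,g^{i_l}) = ζ_m^{a·i₁·[(i₂+i₃)/m]⋯[(i_{l−1}+i_l)/m]}`
is an `l`-cocycle on `Z_m` with values in `kˣ`. -/
theorem statement1 (k : Type*) [Field k] [IsAlgClosed k] [CharZero k]
    (m l : ℕ) (hm : 0 < m) (hl : l % 2 = 1)
    (ζ : kˣ) (hζ : IsPrimitiveRoot ζ m) (a : ℕ) (ha : a < m) :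
    IsCocycle (fun x : Fin l → ZMod m =>
      ζ ^ (a * (x ⟨0, by omega⟩).val *
        ∏ t : Fin ((l - 1) / 2),
          ((x ⟨2 * (t : ℕ) + 1, by have := t.isLt; omega⟩).val +
            (x ⟨2 * (t : ℕ) + 2, by have := t.isLt; omega⟩).val) / m)) := by
  obtain ⟨n, rfl⟩ : ∃ n, l = 2 * n + 1 := ⟨l / 2, by omega⟩
  intro x
  let y : ℕ → ZMod m := fun i => if h : i < 2 * n + 1 + 1 then x ⟨i, h⟩ else 0
  have hy : ∀ (i : ℕ) (h : i < 2 * n + 1 + 1), y i = x ⟨i, h⟩ := fun i h => dif_pos h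
  unfold dCochain
  have s0 : (-1 : ℤ) ^ (2 * n + 1 + 1) = 1 := Even.neg_one_pow ⟨n + 1, by ring⟩
  rw [s0]
  simp only [← zpow_natCast ζ, ← zpow_mul]
  have hprod : ∀ f : Fin (2 * n + 1) → ℤ, ∏ j, ζ ^ f j = ζ ^ ∑ j, f j := by
    intro f
    induction (Finset.univ : Finset (Fin (2 * n + 1))) using Finset.induction_on with
    | empty => simp
    | insert i s hi ih => rw [Finset.prod_insert hi, Finset.sum_insert hi, ih, zpow_add]
  rw [hprod, ← zpow_add, ← zpow_add, hζ.zpow_eq_one_iff_dvd, ← ZMod.intCast_zmod_eq_zero_iff_dvd]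
  simp only [Int.cast_add, Int.cast_sum, Int.cast_mul, Int.cast_natCast, Int.cast_pow,
    Int.cast_neg, Int.cast_one, mul_one]
  rw [expo_bridge m n hm a (fun i => x i.succ) (fun i => y (i + 1))
      (fun i => (hy _ (by omega)).symm),
    expo_bridge m n hm a (fun i => x i.castSucc) y (fun i => (hy _ (by omega)).symm)]
  have hj : ∀ j : Fin (2 * n + 1), _ := fun j => expo_bridge m n hm a
    (fun i : Fin (2 * n + 1) =>
        if (i : ℕ) < (j : ℕ) then x i.castSucc
        else if (i : ℕ) = (j : ℕ) then x i.castSucc + x i.succ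
        else x i.succ) (face m j y) (by
      intro i
      have h1 : y i = x i.castSucc := hy _ (by omega)
      have h2 : y (i + 1) = x i.succ := hy _ (by omega)
      simp only [face, h1, h2])
  simp only [] at hj
  simp only [hj]
  have key := expo_sum m n hm y
  rw [← Fin.sum_univ_eq_sum_range (fun j => (-1) ^ (j + 1) * expo m n (face m j y))] at key
  have e : ∑ j : Fin (2 * n + 1), (a : ZMod m) * expo m n (face m j y) * (-1) ^ ((j : ℕ) + 1) =
      a * ∑ j : Fin (2 * n + 1), (-1) ^ ((j : ℕ) + 1) * expo m n (face m j y) := by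
    rw [Finset.mul_sum]
    exact Finset.sum_congr rfl (fun j _ => by ring)
  rw [e]
  linear_combination (a : ZMod m) * key
end

section
/- Let m be a positive integer and l an odd positive integer. For 0 ≤ a < m define ω_a: (Z_m)^l → k^* on Z_m = ⟨g | g^m = 1⟩ by ω_a(g^{i_1}, …, g^{i_l}) = ζ_m^{a · i_1 · [(i_2+i_3)/m] ⋯ [(i_{l−1}+i_l)/m]} for 0 ≤ i_1, …, i_l < m. Then every l-cocycle ω on Z_m with values in k^* is cohomologous to ω_a for exactly one integer a with 0 ≤ a < m. -/
open scoped BigOperators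

section
universe u
open CategoryTheory
variable {R G : Type u} [CommRing R] [CommGroup G]

theorem exists_of_pi_eq_zero (A : Rep.{u} R G) (n : ℕ) 
    (x : groupCohomology.cocycles A (n+1)) (hx : groupCohomology.π A (n+1) x = 0) :
    ∃ y, inhomogeneousCochains.d A n y = groupCohomology.iCocycles A (n+1) x := by
  have hex : (ShortComplex.mk _ _ ((groupCohomology.inhomogeneousCochains A).toCycles_comp_homologyπ n (n+1))).Exact :=
    ShortComplex.exact_of_g_is_cokernel _
      ((groupCohomology.inhomogeneousCochains A).homologyIsCokernel n (n+1) (by simp))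
  rw [ShortComplex.moduleCat_exact_iff] at hex
  obtain ⟨y, hy⟩ := hex x hx
  refine ⟨y, ?_⟩
  rw [← groupCohomology.inhomogeneousCochains.d_def, ← hy]
  have := (groupCohomology.inhomogeneousCochains A).toCycles_i n (n+1)
  rw [← this]
  rfl

theorem count_lemma [Fintype G] (V : Type u) [AddCommGroup V] [Module R V] (g : G)
    (hg : ∀ x, x ∈ Subgroup.zpowers g) (n : ℕ) (hn : Even n) (N : ℕ)
    (hfin : Finite {v : V // Fintype.card G • v = 0})
    (hcard : Nat.card {v : V // Fintype.card G • v = 0} ≤ N)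
    (F : Fin N → ((Fin (n+1) → G) → V))
    (hF : ∀ i, inhomogeneousCochains.d (Rep.trivial R G V) (n+1) (F i) = 0)
    (hinj : ∀ i j y, inhomogeneousCochains.d (Rep.trivial R G V) n y = F i - F j → i = j)
    (f : (Fin (n+1) → G) → V)
    (hf : inhomogeneousCochains.d (Rep.trivial R G V) (n+1) f = 0) :
    ∃ i y, inhomogeneousCochains.d (Rep.trivial R G V) n y = f - F i := by
  set A := Rep.trivial R G V
  have key : ∀ (f₁ f₂ : (Fin (n+1) → G) → V) (h₁ : inhomogeneousCochains.d A (n+1) f₁ = 0)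
      (h₂ : inhomogeneousCochains.d A (n+1) f₂ = 0),
      groupCohomology.π A (n+1) (groupCohomology.cocyclesMk f₁ h₁) = 
      groupCohomology.π A (n+1) (groupCohomology.cocyclesMk f₂ h₂) → 
      ∃ y, inhomogeneousCochains.d A n y = f₁ - f₂ := by
    intro f₁ f₂ h₁ h₂ h
    rw [← sub_eq_zero, ← map_sub] at h
    obtain ⟨y, hy⟩ := exists_of_pi_eq_zero A n _ h
    refine ⟨y, hy.trans ?_⟩
    rw [map_sub, groupCohomology.iCocycles_mk, groupCohomology.iCocycles_mk]
  have hodd : Odd (n+1) := hn.add_one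
  let p := Rep.FiniteCyclicGroup.groupCohomologyπOdd A g hg (n+1) hodd
  have hp : Function.Surjective p := (ModuleCat.epi_iff_surjective p).1 (by
    have h3 : Epi (Rep.FiniteCyclicGroup.groupCohomologyIsoOdd A g hg (n+1) hodd).inv := inferInstance
    have h2 := epi_comp (Rep.FiniteCyclicGroup.subCompNormHom A g).homologyπ
      (Rep.FiniteCyclicGroup.groupCohomologyIsoOdd A g hg (n+1) hodd).inv
    exact epi_comp' (f := (Rep.FiniteCyclicGroup.subCompNormHom A g).moduleCatCyclesIso.inv) inferInstance h2)
  let q : {v : V // Fintype.card G • v = 0} → groupCohomology A (n+1) := fun v => p ⟨v.1, by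
    have := v.2
    rw [LinearMap.mem_ker]
    simpa [Rep.norm, Representation.norm, A] using this⟩
  have hq : Function.Surjective q := by
    intro c
    obtain ⟨⟨v, hv⟩, rfl⟩ := hp c
    refine ⟨⟨v, ?_⟩, rfl⟩
    rw [LinearMap.mem_ker] at hv
    simpa [Rep.norm, Representation.norm, A] using hv
  have : Finite (groupCohomology A (n+1)) := Finite.of_surjective q hq
  have hc : Nat.card (groupCohomology A (n+1)) ≤ Nat.card (Fin N) := by
    simpa using (Nat.card_le_card_of_surjective q hq).trans hcard
  let Φ : Fin N → groupCohomology A (n+1) := fun i =>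
    groupCohomology.π A (n+1) (groupCohomology.cocyclesMk (F i) (hF i))
  have hΦ : Function.Injective Φ := by
    intro i j hij
    obtain ⟨y, hy⟩ := key _ _ _ _ hij
    exact hinj i j y hy
  have hb : Function.Bijective Φ := hΦ.bijective_of_nat_card_le hc
  obtain ⟨i, hi⟩ := hb.2 (groupCohomology.π A (n+1) (groupCohomology.cocyclesMk f hf))
  exact ⟨i, key _ _ _ _ hi.symm⟩
end

def faceN {G : Type*} [AddGroup G] (p : ℕ) (X : ℕ → G) (k : ℕ) : G :=
  if k + 1 < p then X k else if k + 1 = p then X k + X (k + 1) else X (k + 1)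

/-- Additive coboundary on `ℕ`-indexed sequences. -/
def DN {G V : Type*} [AddGroup G] [AddCommGroup V] {l : ℕ} (f : (Fin l → G) → V) (X : ℕ → G) : V :=
  ∑ p ∈ Finset.range (l + 2), (-1 : ℤ) ^ p • f (fun k => faceN p X k)

section
variable {G V W S : Type*} [AddGroup G] [AddCommGroup V] [AddCommGroup W] [CommRing S]

theorem DN_eq {l : ℕ} (f : (Fin l → G) → V) (X : ℕ → G) :
    DN f X = f (fun i => X (i + 1)) + ∑ j : Fin (l + 1), (-1 : ℤ) ^ ((j : ℕ) + 1) •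
      f (Fin.contractNth j (· + ·) (fun i => X i)) := by
  unfold DN
  rw [Finset.sum_range, Fin.sum_univ_succ]
  congr 1
  · simp [faceN]
  · refine Finset.sum_congr rfl fun j _ => ?_
    simp only [Fin.val_succ]
    congr 2
    funext k
    simp [faceN, Fin.contractNth]

theorem DN_map {l : ℕ} (h : V →+ W) (f : (Fin l → G) → V) (X : ℕ → G) :
    DN (fun x => h (f x)) X = h (DN f X) := by
  simp [DN, map_sum, map_zsmul]

theorem DN_sub {l : ℕ} (f g : (Fin l → G) → V) (X : ℕ → G) :
    DN (fun x => f x - g x) X = DN f X - DN g X := by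
  simp only [DN, zsmul_sub, Finset.sum_sub_distrib]

theorem DN_cup {l : ℕ} (α : (Fin l → G) → S) (c : G → G → S)
    (hc : ∀ x y z, c y z + c x (y + z) = c (x + y) z + c x y) (X : ℕ → G) :
    DN (l := l + 2) (fun x => α (fun i => x (i.castAdd 2)) * c (x (Fin.natAdd l 0)) (x (Fin.natAdd l 1))) X
      = DN α X * c (X (l + 1)) (X (l + 2)) := by
  unfold DN
  rw [Finset.sum_range_succ, Finset.sum_range_succ, Finset.sum_range_succ,
    Finset.sum_range_succ _ (l + 1), add_mul, Finset.sum_mul]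
  have h1 : ∀ p ∈ Finset.range (l + 1), ((-1 : ℤ) ^ p • (α (fun i : Fin l => faceN p X (i.castAdd 2)) *
      c (faceN p X (Fin.natAdd l (0 : Fin 2))) (faceN p X (Fin.natAdd l (1 : Fin 2))))) =
      ((-1 : ℤ) ^ p • α (fun i => faceN p X i)) * c (X (l + 1)) (X (l + 2)) := by
    intro p hp
    rw [Finset.mem_range] at hp
    rw [smul_mul_assoc]
    have e1 : faceN p X (Fin.natAdd l (0 : Fin 2)) = X (l + 1) := by
      simp only [faceN, Fin.val_natAdd, Fin.val_zero]
      rw [if_neg (by omega), if_neg (by omega)]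
    have e2 : faceN p X (Fin.natAdd l (1 : Fin 2)) = X (l + 2) := by
      simp only [faceN, Fin.val_natAdd, Fin.val_one]
      rw [if_neg (by omega), if_neg (by omega)]
    rw [e1, e2]
    rfl
  rw [Finset.sum_congr rfl h1]
  have hf : ∀ p, l < p → (fun i : Fin l => faceN p X i) = fun i : Fin l => X i := by
    intro p hp
    funext i
    have := i.isLt
    simp only [faceN]
    rw [if_pos (by omega)]
  have hf1 := hf (l+1) (by omega)
  have hf2 := hf (l+2) (by omega)
  have hf3 := hf (l+3) (by omega)
  simp only [Fin.val_castAdd, Fin.val_natAdd, Fin.val_zero, Fin.val_one, hf1, hf2, hf3]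
  have a1 : faceN (l+1) X (l+0) = X l + X (l+1) := by simp [faceN]
  have a2 : faceN (l+1) X (l+1) = X (l+2) := by simp [faceN]
  have a3 : faceN (l+2) X (l+0) = X l := by simp [faceN]
  have a4 : faceN (l+2) X (l+1) = X (l+1) + X (l+2) := by simp [faceN]
  have a5 : faceN (l+3) X (l+0) = X l := by simp [faceN]
  have a6 : faceN (l+3) X (l+1) = X (l+1) := by simp [faceN]
  rw [show l + 2 + 1 = l + 3 from rfl, a1, a2, a3, a4, a5, a6]
  have := hc (X l) (X (l+1)) (X (l+2))
  have hc' : c (X (l+1)) (X (l+2)) = c (X l + X (l+1)) (X (l+2)) + c (X l) (X (l+1)) - c (X l) (X (l+1) + X (l+2)) := by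
    rw [← this]; ring
  simp only [pow_succ]
  rw [add_assoc, add_assoc]
  refine congrArg (_ + ·) ?_
  rw [hc']
  simp only [zsmul_eq_mul]
  push_cast
  ring
end

section
variable {m : ℕ} {V : Type*} [AddCommGroup V]

theorem carry_cocycle_s2 (hm : 0 < m) (x y z : ZMod m) :
    (y.val + z.val) / m + (x.val + (y + z).val) / m =
      ((x + y).val + z.val) / m + (x.val + y.val) / m := by
  have : NeZero m := ⟨hm.ne'⟩
  have h1 := Nat.mod_add_div (y.val + z.val) m
  have h2 := Nat.mod_add_div (x.val + (y + z).val) m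
  have h3 := Nat.mod_add_div ((x + y).val + z.val) m
  have h4 := Nat.mod_add_div (x.val + y.val) m
  rw [← ZMod.val_add] at h1 h2 h3 h4
  rw [add_assoc] at h3
  apply Nat.eq_of_mul_eq_mul_left hm
  rw [mul_add, mul_add]
  omega

def EN (m n : ℕ) (x : Fin (2 * n + 1) → ZMod m) : ℕ :=
  (x 0).val * ∏ t : Fin n, (((x ⟨2 * (t : ℕ) + 1, by omega⟩).val +
    (x ⟨2 * (t : ℕ) + 2, by omega⟩).val) / m)

theorem EN_cocycle (hm : 0 < m) (n : ℕ) (X : ℕ → ZMod m) :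
    DN (fun x => (EN m n x : ZMod m)) X = 0 := by
  have : NeZero m := ⟨hm.ne'⟩
  induction n with
  | zero =>
    simp [DN, EN, Finset.sum_range_succ, faceN]
  | succ n ih =>
    have h := DN_cup (fun x => (EN m n x : ZMod m))
      (fun y z => (((y.val + z.val) / m : ℕ) : ZMod m))
      (fun x y z => by exact_mod_cast congrArg (Nat.cast : ℕ → ZMod m) (carry_cocycle_s2 hm x y z)) X
    rw [ih, zero_mul] at h
    rw [← h]
    congr 1
    funext x
    simp only [EN]
    rw [Fin.prod_univ_castSucc, ← mul_assoc, Nat.cast_mul]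
    rfl

/-- test sequence -/
def zs (n : ℕ) (i : Fin n → ZMod m) (k : ℕ) : ZMod m :=
  if k % 2 = 0 then 1 else if h : k / 2 < n then i ⟨k / 2, h⟩ else 0

def us (n t : ℕ) (i : Fin n → ZMod m) (k : ℕ) : ZMod m :=
  if k < 2 * t then zs n i k else zs n i (k + 1)

theorem T_even [NeZero m] (n t : ℕ) (ht : t ≤ n) (f : (Fin (2 * n) → ZMod m) → V) :
    ∑ i : Fin n → ZMod m, f (fun k => faceN (2 * t) (zs n i) k) =
      ∑ i : Fin n → ZMod m, f (fun k => us n t i k) := by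
  rcases t with _ | t
  · simp [us, faceN]
  · refine Fintype.sum_equiv (Equiv.addRight (Pi.single (⟨t, by omega⟩ : Fin n) 1)) _ _ fun i => ?_
    congr 1
    funext ⟨k, hk⟩
    simp only [faceN, us, zs, Equiv.coe_addRight, Pi.add_apply, Pi.single_apply, Fin.ext_iff]
    split_ifs <;> first | omega | simp

theorem T_odd [NeZero m] (n t : ℕ) (ht : t ≤ n) (f : (Fin (2 * n) → ZMod m) → V) :
    ∑ i : Fin n → ZMod m, f (fun k => faceN (2 * t + 1) (zs n i) k) =
      ∑ i : Fin n → ZMod m, f (fun k => us n t i k) := by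
  rcases ht.lt_or_eq with ht | rfl
  · refine Fintype.sum_equiv (Equiv.addRight (Pi.single (⟨t, by omega⟩ : Fin n) 1)) _ _ fun i => ?_
    congr 1
    funext ⟨k, hk⟩
    simp only [faceN, us, zs, Equiv.coe_addRight, Pi.add_apply, Pi.single_apply, Fin.ext_iff]
    split_ifs <;> first | omega | simp [add_comm]
  · refine Finset.sum_congr rfl fun i _ => ?_
    congr 1
    funext ⟨k, hk⟩
    simp [faceN, us, hk]

theorem phi_coboundary [NeZero m] (n : ℕ) (f : (Fin (2 * n) → ZMod m) → V) :
    ∑ i : Fin n → ZMod m, DN f (zs n i) = 0 := by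
  unfold DN
  rw [Finset.sum_comm]
  simp only [← Finset.smul_sum]
  have : ∀ s, s ≤ n + 1 → ∑ p ∈ Finset.range (2 * s), (-1 : ℤ) ^ p •
      ∑ i : Fin n → ZMod m, f (fun k => faceN p (zs n i) k) = 0 := by
    intro s
    induction s with
    | zero => simp
    | succ s ih =>
      intro hs
      rw [show 2 * (s + 1) = 2 * s + 1 + 1 by ring, Finset.sum_range_succ, Finset.sum_range_succ,
        ih (by omega), T_even n s (by omega), T_odd n s (by omega)]
      simp [pow_succ, pow_mul]
  exact this (n + 1) le_rfl

theorem sum_carry (hm : 1 < m) [NeZero m] :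
    ∑ v : ZMod m, (v.val + (1 : ZMod m).val) / m = 1 := by
  have : Fact (1 < m) := ⟨hm⟩
  rw [ZMod.val_one, Finset.sum_eq_single (-1 : ZMod m)]
  · obtain ⟨q, rfl⟩ : ∃ q, m = q + 1 := ⟨m - 1, by omega⟩
    rw [ZMod.val_neg_one]
    exact Nat.div_self (by omega)
  · intro b _ hb
    have h1 := b.val_lt
    refine Nat.div_eq_of_lt ?_
    by_contra h
    apply hb
    have h2 : b.val + 1 = m := by omega
    have h3 := congrArg (Nat.cast : ℕ → ZMod m) h2
    simp at h3
    exact eq_neg_of_add_eq_zero_left h3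
  · simp

theorem phi_EN (n : ℕ) [NeZero m] :
    ∑ i : Fin n → ZMod m, (EN m n (fun k => zs n i k) : ZMod m) = 1 := by
  rcases Nat.lt_or_ge 1 m with hm | hm
  · have : Fact (1 < m) := ⟨hm⟩
    rw [← Nat.cast_sum]
    have : ∑ i : Fin n → ZMod m, EN m n (fun k => zs n i k) = 1 := by
      have e : ∀ i : Fin n → ZMod m, EN m n (fun k => zs n i k) = 
          ∏ t : Fin n, ((i t).val + (1 : ZMod m).val) / m := by
        intro i
        simp only [EN]
        have : zs n i ((0 : Fin (2 * n + 1)) : ℕ) = 1 := by simp [zs]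
        rw [this, ZMod.val_one, one_mul]
        refine Finset.prod_congr rfl fun t _ => ?_
        have h1 : zs n i (2 * (t : ℕ) + 1) = i t := by
          have a : (2 * (t : ℕ) + 1) / 2 = t := by omega
          have b : (2 * (t : ℕ) + 1) % 2 ≠ 0 := by omega
          simp [zs, a]
        have h2 : zs n i (2 * (t : ℕ) + 2) = 1 := by simp [zs]
        rw [h1, h2, ZMod.val_one]
      simp only [e]
      have := Finset.prod_univ_sum (fun _ : Fin n => (Finset.univ : Finset (ZMod m)))
        (fun _ v => (v.val + (1 : ZMod m).val) / m)
      rw [Fintype.piFinset_univ] at this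
      rw [← this]
      simp [sum_carry hm]
    rw [this, Nat.cast_one]
  · have : m = 1 := by have := NeZero.pos m; omega
    subst this
    exact Subsingleton.elim _ _
end

theorem dCochain_eq {G : Type*} [AddGroup G] {k : Type*} [Field k] {l : ℕ}
    (ω : (Fin l → G) → kˣ) (X : ℕ → G) :
    Additive.ofMul (dCochain ω (fun i => X i)) = DN (fun x => Additive.ofMul (ω x)) X := by
  rw [DN_eq, Fin.sum_univ_castSucc, ← add_assoc]
  simp only [dCochain, ofMul_mul, ofMul_prod, ofMul_zpow]
  congr 3
  refine congrArg ω ?_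
  funext i
  simp [Fin.contractNth]

section
universe u
variable {m : ℕ} {V : Type u} [AddCommGroup V]

abbrev Gm (m : ℕ) : Type u := ULift.{u} (Multiplicative (ZMod m))
def toG (x : ZMod m) : Gm.{u} m := ULift.up (Multiplicative.ofAdd x)

theorem d_eq_DN {n : ℕ} (F : (Fin n → Gm.{u} m) → V) (X : ℕ → ZMod m) :
    inhomogeneousCochains.d (Rep.trivial (ULift.{u} ℤ) (Gm.{u} m) V) n F (fun i => toG (X i)) =
      DN (fun x => F (fun i => toG (x i))) X := by
  rw [DN_eq, inhomogeneousCochains.d_hom_apply]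
  congr 1
  refine Finset.sum_congr rfl fun j _ => ?_
  have h : Fin.contractNth j (· * ·) (fun i : Fin (n + 1) => toG.{u} (X i)) =
     fun i => toG (Fin.contractNth j (· + ·) (fun i : Fin (n + 1) => X i) i) := by
    have := Fin.comp_contractNth (f := toG.{u} (m := m)) (· + ·) (· * ·) (fun _ _ => rfl) j
      (fun i : Fin (n + 1) => X i)
    exact this.symm
  rw [h]
  rcases Nat.even_or_odd ((j : ℕ) + 1) with hj | hj
  · simp [hj.neg_one_pow]
  · simp [hj.neg_one_pow]

theorem exists_ext {n : ℕ} (y : Fin n → Gm.{u} m) : ∃ X : ℕ → ZMod m, y = fun i : Fin n => toG (X i) :=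
  ⟨fun k => if h : k < n then (y ⟨k, h⟩).down.toAdd else 0, by funext i; simp [toG]⟩

theorem count_concrete (hm : 0 < m) (n : ℕ)
    (hfin : Finite {v : V // m • v = 0})
    (hcard : Nat.card {v : V // m • v = 0} ≤ m)
    (F : Fin m → ((Fin (2 * n + 1) → ZMod m) → V))
    (hF : ∀ i X, DN (F i) X = 0)
    (hinj : ∀ i j (y : (Fin (2 * n) → ZMod m) → V),
      (∀ X : ℕ → ZMod m, DN y X = F i (fun k => X k) - F j (fun k => X k)) → i = j)
    (f : (Fin (2 * n + 1) → ZMod m) → V) (hf : ∀ X, DN f X = 0) :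
    ∃ i, ∃ y : (Fin (2 * n) → ZMod m) → V,
      ∀ X : ℕ → ZMod m, DN y X = f (fun k => X k) - F i (fun k => X k) := by
  have : NeZero m := ⟨hm.ne'⟩
  have hcG : Fintype.card (Gm.{u} m) = m := by
    rw [Fintype.card_ulift, Fintype.card_multiplicative, ZMod.card]
  let e : Gm.{u} m → ZMod m := fun y => y.down.toAdd
  obtain ⟨i, y, hy⟩ := count_lemma (R := ULift.{u} ℤ) (G := Gm.{u} m) V (toG 1)
    (by
      rintro ⟨x⟩
      refine ⟨(x.toAdd.val : ℤ), ?_⟩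
      change toG 1 ^ ((ZMod.val (Multiplicative.toAdd x) : ℕ) : ℤ) = _
      rw [zpow_natCast]
      apply ULift.down_injective
      apply Multiplicative.toAdd.injective
      change (ZMod.val (Multiplicative.toAdd x)) • (1 : ZMod m) = Multiplicative.toAdd x
      simp) (2 * n) (even_two_mul n) m
    (by rw [hcG]; exact hfin) (by rw [hcG]; exact hcard)
    (fun i y => F i (fun k => e (y k)))
    (by
      intro i
      funext y
      obtain ⟨X, rfl⟩ := exists_ext y
      rw [d_eq_DN]
      exact hF i X)
    (by
      intro i j y hy
      refine hinj i j (fun x => y (fun k => toG (x k))) fun X => ?_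
      rw [← d_eq_DN, hy]
      rfl)
    (fun y => f (fun k => e (y k)))
    (by
      funext y
      obtain ⟨X, rfl⟩ := exists_ext y
      rw [d_eq_DN]
      exact hf X)
  refine ⟨i, fun x => y (fun k => toG (x k)), fun X => ?_⟩
  rw [← d_eq_DN, hy]
  rfl
end

theorem EN_cast (m n : ℕ) (x : Fin (2 * n + 1) → ZMod m) :
    (x ⟨0, by omega⟩).val * ∏ t : Fin ((2 * n + 1 - 1) / 2),
      ((x ⟨2 * (t : ℕ) + 1, by have := t.isLt; omega⟩).val +
                  (x ⟨2 * (t : ℕ) + 2, by have := t.isLt; omega⟩).val) / m = EN m n x := by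
  unfold EN
  congr 1
  exact Fintype.prod_equiv (finCongr (by omega)) _ _ fun t => rfl

theorem main_odd (k : Type*) [Field k] (m n : ℕ) (hm : 0 < m)
    (ζ : kˣ) (hζ : IsPrimitiveRoot ζ m)
    (ω : (Fin (2 * n + 1) → ZMod m) → kˣ) (hω : IsCocycle ω) :
    ∃! a : ℕ, a < m ∧
      ∃ g : (Fin (2 * n) → ZMod m) → kˣ,
        ∀ x : Fin (2 * n + 1) → ZMod m, ω x / ζ ^ (a * EN m n x) = dCochain g x := by
  have : NeZero m := ⟨hm.ne'⟩
  have hext : ∀ (N : ℕ) (x : Fin N → ZMod m), ∃ X : ℕ → ZMod m, x = fun i : Fin N => X i :=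
    fun N x => ⟨fun k => if h : k < N then x ⟨k, h⟩ else 0, by funext i; simp⟩
  let h : ℕ → (ZMod m →+ Additive kˣ) := fun a =>
    ZMod.lift m ⟨zmultiplesHom (Additive kˣ) (Additive.ofMul (ζ ^ a)), by
      have : ζ ^ (a * m) = 1 := by rw [mul_comm, pow_mul, hζ.pow_eq_one, one_pow]
      rw [zmultiplesHom_apply, natCast_zsmul, ← ofMul_pow, ← pow_mul, this]; rfl⟩
  have hh : ∀ a e : ℕ, h a (e : ZMod m) = Additive.ofMul (ζ ^ (a * e)) := by
    intro a e
    have := ZMod.lift_coe m ⟨zmultiplesHom (Additive kˣ) (Additive.ofMul (ζ ^ a)), by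
      have : ζ ^ (a * m) = 1 := by rw [mul_comm, pow_mul, hζ.pow_eq_one, one_pow]
      rw [zmultiplesHom_apply, natCast_zsmul, ← ofMul_pow, ← pow_mul, this]; rfl⟩ (e : ℤ)
    rw [Int.cast_natCast] at this
    refine this.trans ?_
    simp [pow_mul]
  have hinj : ∀ a b : ℕ, a < m → b < m → ∀ y : (Fin (2 * n) → ZMod m) → Additive kˣ,
      (∀ X : ℕ → ZMod m, DN y X = h a (EN m n (fun k => X k) : ℕ) - h b (EN m n (fun k => X k) : ℕ)) →
      a = b := by
    intro a b ha hb y hy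
    have h0 := phi_coboundary n y
    simp only [hy] at h0
    rw [Finset.sum_sub_distrib, ← map_sum, ← map_sum, phi_EN, sub_eq_zero,
      ← Nat.cast_one, hh, hh, mul_one, mul_one] at h0
    exact hζ.pow_inj ha hb (Additive.ofMul.injective h0)
  have hroots : {v : Additive kˣ // m • v = 0} ≃ rootsOfUnity m k :=
    Additive.toMul.subtypeEquiv fun v => by
      rw [mem_rootsOfUnity, ← toMul_nsmul]
      exact Iff.rfl
  obtain ⟨i, y, hy⟩ := count_concrete (V := Additive kˣ) hm n (Finite.of_equiv _ hroots.symm)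
    (by rw [Nat.card_congr hroots]; exact card_rootsOfUnity k m)
    (fun i x => h i (EN m n x : ℕ))
    (fun i X => by rw [DN_map, EN_cocycle hm, map_zero])
    (fun i j y hy => Fin.ext (hinj i j i.2 j.2 y hy))
    (fun x => Additive.ofMul (ω x))
    (fun X => by rw [← dCochain_eq, hω]; rfl)
  refine ⟨i, ⟨i.2, fun x => (y x).toMul, fun x => ?_⟩, ?_⟩
  · obtain ⟨X, rfl⟩ := hext _ x
    apply Additive.ofMul.injective
    rw [dCochain_eq]
    refine Eq.trans ?_ (hy X).symm
    rw [hh]; rfl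
  · rintro b ⟨hb, g, hg⟩
    refine hinj b i hb i.2 (fun x => y x - Additive.ofMul (g x)) fun X => ?_
    have h1 : DN (fun x => y x - Additive.ofMul (g x)) X =
        DN y X - DN (fun x => Additive.ofMul (g x)) X :=
      DN_sub _ _ X
    rw [h1, hy X, ← dCochain_eq, ← hg, hh, hh, ofMul_div]
    abel

/-- For `m > 0` and `l` an odd positive integer, every `l`-cocycle on
`Z_m` with values in `kˣ` is cohomologous to
`ω_a(g^{i₁},…,g^{i_l}) = ζ_m^{a·i₁·[(i₂+i₃)/m]⋯[(i_{l−1}+i_l)/m]}`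
for exactly one integer `0 ≤ a < m`; i.e. the ratio `ω / ω_a` is the coboundary of an
`(l−1)`-cochain. -/
theorem statement2 (k : Type*) [Field k] [IsAlgClosed k] [CharZero k]
    (m l : ℕ) (hm : 0 < m) (hl : l % 2 = 1)
    (ζ : kˣ) (hζ : IsPrimitiveRoot ζ m)
    (ω : (Fin l → ZMod m) → kˣ) (hω : IsCocycle ω) :
    ∃! a : ℕ, a < m ∧
      ∃ g : (Fin (l - 1) → ZMod m) → kˣ,
        ∀ x : Fin l → ZMod m,
          ω x / (ζ ^ (a * (x ⟨0, by omega⟩).val *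
              ∏ t : Fin ((l - 1) / 2),
                ((x ⟨2 * (t : ℕ) + 1, by have := t.isLt; omega⟩).val +
                  (x ⟨2 * (t : ℕ) + 2, by have := t.isLt; omega⟩).val) / m)) =
            dCochain g (fun i => x (Fin.cast (by omega : l - 1 + 1 = l) i)) := by
  obtain ⟨n, rfl⟩ : ∃ n, l = 2 * n + 1 := ⟨l / 2, by omega⟩
  have h := main_odd k m n hm ζ hζ ω hω
  simp only [← EN_cast, ← mul_assoc] at h
  exact h
end

section
/- Let m, n be positive integers and G = Z_m × Z_n. Then each Φ_{a,b,d} (for integers 0 ≤ a < m, 0 ≤ b < gcd(m,n), 0 ≤ d < n) is a normalized 3-cocycle on G with values in k^*, and every normalized 3-cocycle on G with values in k^* is cohomologous to Φ_{a,b,d} for exactly one triple (a,b,d) with 0 ≤ a < m, 0 ≤ b < gcd(m,n), 0 ≤ d < n. -/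
/-- A 3-cochain `Φ : G×G×G → kˣ` (trivial action) is a 3-cocycle if
`Φ(y,z,w)·Φ(xy,z,w)⁻¹·Φ(x,yz,w)·Φ(x,y,zw)⁻¹·Φ(x,y,z) = 1` for all `x,y,z,w ∈ G`. -/
def Is3Cocycle {G : Type*} [AddGroup G] {k : Type*} [Field k]
    (Φ : G → G → G → kˣ) : Prop :=
  ∀ x y z w : G,
    Φ y z w * (Φ (x + y) z w)⁻¹ * Φ x (y + z) w * (Φ x y (z + w))⁻¹ * Φ x y z = 1

/-- A 3-cochain is normalized if it takes the value `1` whenever one of its arguments is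
the identity. -/
def IsNormalized3Cochain {G : Type*} [AddGroup G] {k : Type*} [Field k]
    (Φ : G → G → G → kˣ) : Prop :=
  ∀ x y z : G, (x = 0 ∨ y = 0 ∨ z = 0) → Φ x y z = 1

/-- The 3-cocycle
`Φ_{a,b,d}(g₁^i g₂^j, g₁^s g₂^t, g₁^k g₂^l) = ζ_m^{a·i·[(s+k)/m]} · ζ_n^{b·j·[(s+k)/m]} · ζ_n^{d·j·[(t+l)/n]}`
on `Z_m × Z_n` (written additively), with values in `kˣ`. -/
noncomputable def PhiABD {k : Type*} [Field k] (m n : ℕ) (ζm ζn : kˣ) (a b d : ℕ)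
    (x y z : ZMod m × ZMod n) : kˣ :=
  ζm ^ (a * x.1.val * ((y.1.val + z.1.val) / m)) *
    ζn ^ (b * x.2.val * ((y.1.val + z.1.val) / m)) *
    ζn ^ (d * x.2.val * ((y.2.val + z.2.val) / n))


set_option linter.unusedSectionVars false

namespace S10
open Finset

section gen
variable {G A : Type*} [AddCommGroup G] [AddCommGroup A]

def Coc (Φ : G → G → G → A) : Prop :=
  ∀ x y z w, Φ y z w - Φ (x + y) z w + Φ x (y + z) w - Φ x y (z + w) + Φ x y z = 0

def S (Φ : G → G → G → A) (g : G) (r : ℕ) (x : G) : A := ∑ j ∈ range r, Φ x (j • g) g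

def Sh (Φ : G → G → G → A) (g h : G) (r : ℕ) : A :=
  ∑ j ∈ range r, (Φ (j • g) g h - Φ (j • g) h g + Φ h (j • g) g)

/-- telescoping -/
lemma tele (P : G → A) (g : G) (r : ℕ) (hr : r • g = 0) (x : G) :
    ∑ j ∈ range r, P (x + j • g + g) = ∑ j ∈ range r, P (x + j • g) := by
  have h := Finset.sum_range_sub (fun j => P (x + j • g)) r
  simp only [hr, zero_nsmul, sub_self, Finset.sum_sub_distrib, sub_eq_zero] at h
  rw [← h]
  refine Finset.sum_congr rfl fun j _ => ?_
  rw [succ_nsmul, add_assoc]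

lemma S_shift {Φ : G → G → G → A} (hc : Coc Φ) (g : G) (r : ℕ) (hr : r • g = 0) (x : G) :
    S Φ g r (x + g) = S Φ g r x + S Φ g r g := by
  have h : ∑ j ∈ range r, (Φ g (j • g) g - Φ (x + g) (j • g) g + Φ x (g + j • g) g
      - Φ x g (j • g + g) + Φ x g (j • g)) = 0 :=
    Finset.sum_eq_zero fun j _ => hc x g (j • g) g
  have h1 := tele (fun y => Φ x y g) g r hr 0
  have h2 := tele (fun y => Φ x g y) g r hr 0
  simp only [zero_add] at h1 h2
  simp only [Finset.sum_add_distrib, Finset.sum_sub_distrib] at h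
  have h3 : ∑ j ∈ range r, Φ x (g + j • g) g = ∑ j ∈ range r, Φ x (j • g) g := by
    rw [← h1]; exact Finset.sum_congr rfl fun j _ => by rw [add_comm]
  rw [h3, h2] at h
  simp only [S]
  rw [← sub_eq_zero, ← neg_eq_zero, ← h]; abel

lemma Sh_lem {Φ : G → G → G → A} (hc : Coc Φ) (g h : G) (r : ℕ) (hr : r • g = 0) (x : G) :
    ∑ j ∈ range r, (Φ (x + j • g) g h - Φ (x + j • g) h g) + S Φ g r (x + h) - S Φ g r x
      = Sh Φ g h r := by
  have key : ∑ j ∈ range r, ((Φ (j • g) g h - Φ (x + j • g) g h + Φ x (j • g + g) h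
        - Φ x (j • g) (g + h) + Φ x (j • g) g)
      - (Φ (j • g) h g - Φ (x + j • g) h g + Φ x (j • g + h) g
        - Φ x (j • g) (h + g) + Φ x (j • g) h)
      + (Φ h (j • g) g - Φ (x + h) (j • g) g + Φ x (h + j • g) g
        - Φ x h (j • g + g) + Φ x h (j • g))) = 0 :=
    Finset.sum_eq_zero fun j _ => by
      rw [hc x (j • g) g h, hc x (j • g) h g, hc x h (j • g) g]; simp
  have h1 := tele (fun y => Φ x y h) g r hr 0
  have h2 := tele (fun y => Φ x h y) g r hr 0
  simp only [zero_add] at h1 h2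
  simp only [add_comm h] at key
  simp only [Finset.sum_add_distrib, Finset.sum_sub_distrib] at key
  rw [h1, h2] at key
  simp only [S, Sh, Finset.sum_add_distrib, Finset.sum_sub_distrib]
  rw [← sub_eq_zero, ← neg_eq_zero, ← key]; abel

lemma Sh_rel {Φ : G → G → G → A} (hc : Coc Φ) (g h : G) (r s : ℕ) (hr : r • g = 0)
    (hs : s • h = 0) : s • Sh Φ g h r + r • Sh Φ h g s = 0 := by
  have h1 : ∑ i ∈ range s, Sh Φ g h r = s • Sh Φ g h r := by simp
  have h2 : ∑ i ∈ range r, Sh Φ h g s = r • Sh Φ h g s := by simp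
  rw [← h1, ← h2, Finset.sum_congr rfl fun i _ => (Sh_lem hc g h r hr (i • h)).symm,
    Finset.sum_congr rfl fun i _ => (Sh_lem hc h g s hs (i • g)).symm]
  have t1 := tele (S Φ g r) h s hs 0
  have t2 := tele (S Φ h s) g r hr 0
  simp only [zero_add] at t1 t2
  simp only [Finset.sum_add_distrib, Finset.sum_sub_distrib, t1, t2]
  rw [Finset.sum_comm (s := range r)]
  rw [Finset.sum_comm (s := range r)]
  simp only [add_comm]
  abel

/-- invariants of a coboundary -/
lemma S_cob (f : G → G → A) (Φ : G → G → G → A)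
    (hf : ∀ x y z, Φ x y z = f y z - f (x + y) z + f x (y + z) - f x y)
    (g : G) (r : ℕ) (hr : r • g = 0) : S Φ g r g = 0 := by
  have t1 := tele (fun y => f y g) g r hr 0
  have t2 := tele (fun y => f g y) g r hr 0
  simp only [zero_add] at t1 t2
  simp only [S, hf, add_comm g, Finset.sum_add_distrib, Finset.sum_sub_distrib, t1, t2]
  abel

lemma Sh_cob (f : G → G → A) (Φ : G → G → G → A)
    (hf : ∀ x y z, Φ x y z = f y z - f (x + y) z + f x (y + z) - f x y)
    (g h : G) (r : ℕ) (hr : r • g = 0) : Sh Φ g h r = r • (f g h - f h g) := by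
  have t1 := tele (fun y => f y h) g r hr 0
  have t2 := tele (fun y => f h y) g r hr 0
  simp only [zero_add] at t1 t2
  simp only [Sh, hf, add_comm h, Finset.sum_add_distrib, Finset.sum_sub_distrib, t1, t2,
    Finset.sum_const, card_range, smul_sub]
  abel

/-- The extension of `G` attached to a normalized cocycle. -/
@[ext] structure E (Φ : G → G → G → A) where
  F : G → A
  g : G
  h0 : F 0 = 0

def Nor (Φ : G → G → G → A) : Prop := ∀ x y z, (x = 0 ∨ y = 0 ∨ z = 0) → Φ x y z = 0

@[reducible] def mon {Φ : G → G → G → A} (hc : Coc Φ) (hn : Nor Φ) : Monoid (E Φ) where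
  mul u v := ⟨fun x => u.F x + v.F (x + u.g) - v.F u.g + Φ x u.g v.g, u.g + v.g, by
    rw [u.h0, hn _ _ _ (Or.inl rfl)]; simp⟩
  one := ⟨fun _ => 0, 0, rfl⟩
  mul_assoc u v w := by
    have := hc
    apply E.ext
    · funext x
      have h := hc x u.g v.g w.g
      change u.F x + v.F (x + u.g) - v.F u.g + Φ x u.g v.g + w.F (x + (u.g + v.g))
        - w.F (u.g + v.g) + Φ x (u.g + v.g) w.g = 
        u.F x + (v.F (x + u.g) + w.F (x + u.g + v.g) - w.F v.g + Φ (x + u.g) v.g w.g)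
        - (v.F u.g + w.F (u.g + v.g) - w.F v.g + Φ u.g v.g w.g) + Φ x u.g (v.g + w.g)
      rw [← sub_eq_zero, ← h, add_assoc x]; abel
    · exact add_assoc _ _ _
  one_mul u := by
    apply E.ext
    · funext x
      change 0 + u.F (x + 0) - u.F 0 + Φ x 0 u.g = u.F x
      rw [u.h0, hn _ _ _ (Or.inr (Or.inl rfl))]; simp
    · exact zero_add _
  mul_one u := by
    apply E.ext
    · funext x
      change u.F x + 0 - 0 + Φ x u.g 0 = u.F x
      rw [hn _ _ _ (Or.inr (Or.inr rfl))]; simp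
    · exact add_zero _

lemma pow_form {Φ : G → G → G → A} (hc : Coc Φ) (hn : Nor Φ) (u : E Φ) (j : ℕ) :
    letI := mon hc hn
    (u ^ j).g = j • u.g ∧ ∀ x, (u ^ j).F x =
      ∑ i ∈ range j, (u.F (x + i • u.g) - u.F (i • u.g)) + S Φ u.g j x := by
  let _ := mon hc hn
  induction j with
  | zero => 
    rw [pow_zero]
    exact ⟨(zero_nsmul _).symm, fun x => by simp [S]; rfl⟩
  | succ j ih =>
    rw [pow_succ]
    refine ⟨?_, fun x => ?_⟩
    · change (u ^ j).g + u.g = _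
      rw [ih.1, succ_nsmul]
    · change (u ^ j).F x + u.F (x + (u ^ j).g) - u.F (u ^ j).g + Φ x (u ^ j).g u.g = _
      rw [ih.1, ih.2, Finset.sum_range_succ, S, S, Finset.sum_range_succ]; abel

end gen

section zm
variable {A : Type*} [AddCommGroup A] {m n : ℕ} [NeZero m] [NeZero n]

lemma sum_cast (h : ZMod m → A) : ∑ j ∈ range m, h (j : ZMod m) = ∑ i, h i := by
  refine Finset.sum_bij' (fun j _ => (j : ZMod m)) (fun i _ => i.val) ?_ ?_ ?_ ?_ ?_
  · simp
  · intro i _; simpa using ZMod.val_lt i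
  · intro j hj; exact ZMod.val_cast_of_lt (by simpa using hj)
  · intro i _; simp
  · simp

lemma sum_cast_add (h : ZMod m → A) (x : ZMod m) :
    ∑ j ∈ range m, h (x + (j : ZMod m)) = ∑ i, h i := by
  rw [sum_cast (fun i => h (x + i))]
  exact Equiv.sum_comp (Equiv.addLeft x) h

/-- antidifference on `ZMod m` -/
lemma antidiff (h : ZMod m → A) (h0 : ∑ i, h i = 0) (i : ZMod m) :
    ∑ j ∈ range (i + 1).val, h (j : ZMod m) = ∑ j ∈ range i.val, h (j : ZMod m) + h i := by
  have e : ∑ j ∈ range i.val, h (j : ZMod m) + h i = ∑ j ∈ range (i.val + 1), h (j : ZMod m) := by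
    rw [Finset.sum_range_succ]; simp
  rw [e]
  have hi := ZMod.val_lt i
  have hv : (i + 1).val = (i.val + 1) % m := by
    rw [ZMod.val_add, ZMod.val_one_eq_one_mod]; simp
  rcases Nat.lt_or_ge (i.val + 1) m with hlt | hge
  · rw [hv, Nat.mod_eq_of_lt hlt]
  · have hm : i.val + 1 = m := by omega
    rw [hv, hm, Nat.mod_self, sum_cast, h0]; simp

abbrev g1 (m n : ℕ) : ZMod m × ZMod n := (1, 0)
abbrev g2 (m n : ℕ) : ZMod m × ZMod n := (0, 1)

lemma ng1 (j : ℕ) : j • g1 m n = ((j : ZMod m), 0) := by simp [g1]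
lemma ng2 (j : ℕ) : j • g2 m n = (0, (j : ZMod n)) := by simp [g2]
lemma mg1 : m • g1 m n = 0 := by rw [ng1]; simp
lemma mg2 : n • g2 m n = 0 := by rw [ng2]; simp

/-- an invariant function -/
lemma inv1 (P : ZMod m × ZMod n → A) (hP : ∀ x, P (x + g1 m n) = P x)
    (x : ZMod m × ZMod n) : P (0, x.2) = P x := by
  have h : ∀ j : ℕ, P ((0, x.2) + j • g1 m n) = P (0, x.2) := by
    intro j
    induction j with
    | zero => simp
    | succ j ih => rw [succ_nsmul, ← add_assoc, hP, ih]
  rw [← h x.1.val, ng1]; simp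

lemma inv2 (P : ZMod m × ZMod n → A) (hP : ∀ x, P (x + g2 m n) = P x)
    (x : ZMod m × ZMod n) : P (x.1, 0) = P x := by
  have h : ∀ j : ℕ, P ((x.1, 0) + j • g2 m n) = P (x.1, 0) := by
    intro j
    induction j with
    | zero => simp
    | succ j ih => rw [succ_nsmul, ← add_assoc, hP, ih]
  rw [← h x.2.val, ng2]; simp

lemma S_zero {G : Type*} [AddCommGroup G] {Φ : G → G → G → A} (hn : Nor Φ) (g : G) (r : ℕ) :
    S Φ g r 0 = 0 :=
  Finset.sum_eq_zero fun _ _ => hn _ _ _ (Or.inl rfl)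

lemma exists_beta1 {Φ : ZMod m × ZMod n → ZMod m × ZMod n → ZMod m × ZMod n → A}
    (hc : Coc Φ) (hn : Nor Φ) (h : S Φ (g1 m n) m (g1 m n) = 0) :
    ∃ β : ZMod m × ZMod n → A, β 0 = 0 ∧
      ∀ x, ∑ j ∈ range m, β (x + j • g1 m n) = - S Φ (g1 m n) m x := by
  refine ⟨fun x => if x.1 = 0 then - S Φ (g1 m n) m (0, x.2) else 0, ?_, fun x => ?_⟩
  · have := S_zero hn (g1 m n) m
    rw [show (0 : ZMod m × ZMod n) = (0, 0) from rfl] at this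
    simpa using this
  · have hs := inv1 (S Φ (g1 m n) m) (fun x => by rw [S_shift hc _ _ mg1, h, add_zero]) x
    have := sum_cast_add (m := m) (fun i => if i = 0 then - S Φ (g1 m n) m (0, x.2) else 0) x.1
    simp only [ng1, Prod.fst_add, Prod.snd_add, add_zero]
    rw [this]
    simp [hs]

lemma exists_beta2 {Φ : ZMod m × ZMod n → ZMod m × ZMod n → ZMod m × ZMod n → A}
    (hc : Coc Φ) (hn : Nor Φ) (h : S Φ (g2 m n) n (g2 m n) = 0) :
    ∃ β : ZMod m × ZMod n → A, β 0 = 0 ∧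
      ∀ x, ∑ j ∈ range n, β (x + j • g2 m n) = - S Φ (g2 m n) n x := by
  refine ⟨fun x => if x.2 = 0 then - S Φ (g2 m n) n (x.1, 0) else 0, ?_, fun x => ?_⟩
  · have := S_zero hn (g2 m n) n
    rw [show (0 : ZMod m × ZMod n) = (0, 0) from rfl] at this
    simpa using this
  · have hs := inv2 (S Φ (g2 m n) n) (fun x => by rw [S_shift hc _ _ mg2, h, add_zero]) x
    have := sum_cast_add (m := n) (fun i => if i = 0 then - S Φ (g2 m n) n (x.1, 0) else 0) x.2
    simp only [ng2, Prod.fst_add, Prod.snd_add, add_zero]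
    rw [this]
    simp [hs]

lemma exists_rho (γ : ZMod m × ZMod n → A)
    (h1 : ∀ x, ∑ j ∈ range m, γ (x + j • g1 m n) = 0)
    (h2 : ∀ x, ∑ j ∈ range n, γ (x + j • g2 m n) = 0) :
    ∃ ρ : ZMod m × ZMod n → A, (∀ x, ρ (x + g1 m n) = ρ x - γ x) ∧
      ∀ x, ∑ j ∈ range n, ρ (x + j • g2 m n) = 0 := by
  refine ⟨fun x => - ∑ i ∈ range x.1.val, γ ((i : ZMod m), x.2), fun x => ?_, fun x => ?_⟩
  · have := antidiff (fun i => γ (i, x.2)) (by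
      have := h1 (0, x.2)
      simp only [ng1, Prod.mk_add_mk, add_zero, zero_add] at this
      rw [← sum_cast]; exact this) x.1
    simp only [Prod.fst_add, Prod.snd_add, add_zero]
    rw [this]; simp only [Prod.mk.eta]; abel
  · rw [Finset.sum_neg_distrib, neg_eq_zero]
    simp only [ng2, Prod.fst_add, Prod.snd_add, add_zero]
    rw [Finset.sum_comm]
    refine Finset.sum_eq_zero fun i _ => ?_
    have := h2 ((i : ZMod m), x.2)
    simpa only [ng2, Prod.mk_add_mk, add_zero] using this

lemma pow_val {M : Type*} [Monoid M] (u : M) (hu : u ^ m = 1) (a b : ZMod m) :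
    u ^ (a + b).val = u ^ a.val * u ^ b.val := by
  rw [ZMod.val_add, ← pow_add, ← pow_eq_pow_mod _ hu]

theorem split {Φ : ZMod m × ZMod n → ZMod m × ZMod n → ZMod m × ZMod n → A}
    (hc : Coc Φ) (hn : Nor Φ) (hI1 : S Φ (g1 m n) m (g1 m n) = 0)
    (hI2 : S Φ (g2 m n) n (g2 m n) = 0) (e : A)
    (h21 : Sh Φ (g1 m n) (g2 m n) m = m • e) (h12 : Sh Φ (g2 m n) (g1 m n) n = - (n • e)) :
    ∃ f : ZMod m × ZMod n → ZMod m × ZMod n → A,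
      ∀ x y z, Φ x y z = f y z - f (x + y) z + f x (y + z) - f x y := by
  obtain ⟨β1, b10, hb1⟩ := exists_beta1 hc hn hI1
  obtain ⟨β2, b20, hb2⟩ := exists_beta2 hc hn hI2
  set p := g1 m n with hp
  set q := g2 m n with hq
  obtain ⟨ρ, hρ1, hρ2⟩ := exists_rho (m := m) (n := n) (fun x => β1 x - β1 (x + q) + β2 (x + p) - β2 x
      + Φ x p q - Φ x q p - e) (fun x => by
    have h := Sh_lem hc p q m mg1 x
    have t := tele β2 p m mg1 x
    have s := hb1 (x + q)
    simp only [add_right_comm x q] at s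
    rw [← hp]
    simp only [Finset.sum_add_distrib, Finset.sum_sub_distrib, t, hb1, s, Finset.sum_const,
      card_range, ← h21, ← h]
    abel) (fun x => by
    have h := Sh_lem hc q p n mg2 x
    have t := tele β1 q n mg2 x
    have s := hb2 (x + p)
    simp only [add_right_comm x p] at s
    have h12' : n • e = - Sh Φ q p n := by rw [h12, neg_neg]
    rw [← hq]
    simp only [Finset.sum_add_distrib, Finset.sum_sub_distrib, t, hb2, s, Finset.sum_const,
      card_range, h12', ← h]
    abel)
  rw [← hp] at hρ1
  rw [← hq] at hρ2
  let _ := mon hc hn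
  let u1 : E Φ := ⟨β1, p, b10⟩
  let u2 : E Φ := ⟨fun x => β2 x + ρ x - ρ 0, q, by simp [b20]⟩
  have e1 : u1 ^ m = 1 := by
    obtain ⟨pg, pF⟩ := pow_form hc hn u1 m
    apply E.ext
    · funext x
      rw [pF]
      change ∑ i ∈ range m, (β1 (x + i • p) - β1 (i • p)) + S Φ p m x = 0
      have := hb1 0
      simp only [zero_add] at this
      rw [Finset.sum_sub_distrib, hb1, this, S_zero hn]; abel
    · rw [pg]; exact mg1
  have e2 : u2 ^ n = 1 := by
    obtain ⟨pg, pF⟩ := pow_form hc hn u2 n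
    apply E.ext
    · funext x
      rw [pF]
      change ∑ i ∈ range n, ((β2 (x + i • q) + ρ (x + i • q) - ρ 0)
        - (β2 (i • q) + ρ (i • q) - ρ 0)) + S Φ q n x = 0
      have := hb2 0
      have h := hρ2 0
      simp only [zero_add] at this h
      simp only [Finset.sum_sub_distrib, Finset.sum_add_distrib, hb2, hρ2, h, this, S_zero hn]; abel
    · rw [pg]; exact mg2
  have ec : Commute u1 u2 := by
    apply E.ext
    · funext x
      change β1 x + (β2 (x + p) + ρ (x + p) - ρ 0) - (β2 p + ρ p - ρ 0) + Φ x p q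
        = (β2 x + ρ x - ρ 0) + β1 (x + q) - β1 q + Φ x q p
      have h0 := hρ1 0
      simp only [zero_add, b10, b20, hn 0 _ _ (Or.inl rfl)] at h0
      rw [hρ1, h0]; abel
    · exact add_comm _ _
  let s : ZMod m × ZMod n → E Φ := fun x => u1 ^ x.1.val * u2 ^ x.2.val
  have hs : ∀ x y, s (x + y) = s x * s y := by
    intro x y
    change u1 ^ (x.1 + y.1).val * u2 ^ (x.2 + y.2).val = _
    rw [pow_val u1 e1, pow_val u2 e2, mul_assoc, ← mul_assoc (u1 ^ y.1.val),
      (ec.pow_pow y.1.val x.2.val).eq]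
    simp only [s, mul_assoc]
  have hg : ∀ x, (s x).g = x := by
    intro x
    change (u1 ^ x.1.val).g + (u2 ^ x.2.val).g = x
    rw [(pow_form hc hn u1 _).1, (pow_form hc hn u2 _).1]
    change x.1.val • g1 m n + x.2.val • g2 m n = x
    rw [ng1, ng2]; simp
  refine ⟨fun x y => (s y).F x, fun x y z => ?_⟩
  have h : (s (y + z)).F x = (s y).F x + (s z).F (x + (s y).g) - (s z).F (s y).g
      + Φ x (s y).g (s z).g := by rw [hs]; rfl
  rw [hg, hg] at h
  simp only [h]; abel

end zm
end S10

namespace S10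
open Finset

section phi
variable {A : Type*} [AddCommGroup A] {m n : ℕ} [NeZero m] [NeZero n]

lemma coc_term {G : Type*} [AddCommGroup G] (ψ : G → A) (c : G → G → ℕ)
    (hψ : ∀ x y, ψ (x + y) = ψ x + ψ y)
    (hc : ∀ y z w, c y z + c (y + z) w = c z w + c y (z + w)) :
    Coc (fun x y z => c y z • ψ x) := by
  intro x y z w
  have h := congrArg (fun t => t • ψ x) (hc y z w)
  simp only [add_smul] at h
  simp only [hψ, smul_add]
  rw [← sub_eq_zero] at h
  rw [← h]; abel

lemma carry (y z : ZMod m) : y.val + z.val = (y + z).val + m * ((y.val + z.val) / m) := by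
  rw [ZMod.val_add, Nat.mod_add_div]

lemma carry_coc (y z w : ZMod m) :
    (y.val + z.val) / m + ((y + z).val + w.val) / m
      = (z.val + w.val) / m + (y.val + (z + w).val) / m := by
  have h1 := carry y z
  have h2 := carry (y + z) w
  have h3 := carry z w
  have h4 := carry y (z + w)
  rw [add_assoc y z w] at h2
  have hm : 0 < m := Nat.pos_of_ne_zero (NeZero.ne m)
  apply Nat.eq_of_mul_eq_mul_left hm
  rw [mul_add, mul_add]
  omega

lemma val_smul_add (ζ : A) (h : m • ζ = 0) (x y : ZMod m) :
    (x + y).val • ζ = x.val • ζ + y.val • ζ := by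
  rw [← add_smul, carry x y, add_smul, mul_comm, mul_smul, h]; simp

lemma Coc.add {G : Type*} [AddCommGroup G] {Φ Ψ : G → G → G → A} (h1 : Coc Φ) (h2 : Coc Ψ) :
    Coc (fun x y z => Φ x y z + Ψ x y z) := by
  intro x y z w
  rw [← add_zero (0 : A)]
  nth_rw 1 [← h1 x y z w]
  rw [← h2 x y z w]
  beta_reduce
  abel

lemma Coc.sub {G : Type*} [AddCommGroup G] {Φ Ψ : G → G → G → A} (h1 : Coc Φ) (h2 : Coc Ψ) :
    Coc (fun x y z => Φ x y z - Ψ x y z) := by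
  intro x y z w
  rw [← sub_zero (0 : A)]
  nth_rw 1 [← h1 x y z w]
  rw [← h2 x y z w]
  beta_reduce
  abel

/-- additive form of `PhiABD` -/
def P (m n : ℕ) (ζm ζn : A) (a b d : ℕ) (x y z : ZMod m × ZMod n) : A :=
  ((y.1.val + z.1.val) / m) • (x.1.val • a • ζm) +
    ((y.1.val + z.1.val) / m) • (x.2.val • b • ζn) +
    ((y.2.val + z.2.val) / n) • (x.2.val • d • ζn)

lemma P_coc (ζm ζn : A) (hm : m • ζm = 0) (hn : n • ζn = 0) (a b d : ℕ) :
    Coc (P m n ζm ζn a b d) := by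
  have hm' : m • a • ζm = 0 := by rw [smul_comm, hm, smul_zero]
  have hb' : n • b • ζn = 0 := by rw [smul_comm, hn, smul_zero]
  have hd' : n • d • ζn = 0 := by rw [smul_comm, hn, smul_zero]
  refine Coc.add (Coc.add (coc_term _ _ ?_ ?_) (coc_term _ _ ?_ ?_)) (coc_term _ _ ?_ ?_)
  · exact fun x y => val_smul_add _ hm' _ _
  · exact fun x y z => carry_coc _ _ _
  · exact fun x y => val_smul_add _ hb' _ _
  · exact fun x y z => carry_coc _ _ _
  · exact fun x y => val_smul_add _ hd' _ _
  · exact fun x y z => carry_coc _ _ _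

lemma P_nor (ζm ζn : A) (a b d : ℕ) : Nor (P m n ζm ζn a b d) := by
  rintro x y z (rfl | rfl | rfl) <;> simp [P, Nat.div_eq_of_lt (ZMod.val_lt _)]

lemma sum_carry (ζ : A) (h : m = 1 → ζ = 0) :
    ∑ j ∈ range m, (((j : ZMod m).val + (1 : ZMod m).val) / m) • ζ = ζ := by
  obtain ⟨r, rfl⟩ := Nat.exists_eq_succ_of_ne_zero (NeZero.ne m)
  rcases Nat.eq_zero_or_pos r with rfl | hr
  · rw [h rfl]; simp
  · rw [Finset.sum_range_succ, Finset.sum_eq_zero, zero_add]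
    · have : Fact (1 < r.succ) := ⟨by omega⟩
      rw [ZMod.val_cast_of_lt (by omega), ZMod.val_one, Nat.div_self (by omega), one_smul]
    · intro j hj
      have : Fact (1 < r.succ) := ⟨by omega⟩
      rw [mem_range] at hj
      rw [ZMod.val_cast_of_lt (by omega), ZMod.val_one, Nat.div_eq_of_lt (by omega), zero_smul]

lemma one_val_smul (ζ : A) (h : m • ζ = 0) : (1 : ZMod m).val • ζ = ζ := by
  rw [ZMod.val_one_eq_one_mod]
  rcases Nat.lt_or_ge 1 m with h1 | h1
  · rw [Nat.mod_eq_of_lt h1, one_smul]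
  · have : m = 1 := by have := NeZero.ne m; omega
    subst this; simpa using h.symm

lemma P_S1 (ζm ζn : A) (hm : m • ζm = 0) (a b d : ℕ) :
    S (P m n ζm ζn a b d) (g1 m n) m (g1 m n) = a • ζm := by
  have hm' : m • a • ζm = 0 := by rw [smul_comm, hm, smul_zero]
  simp only [S, P, ng1, ZMod.val_zero, zero_smul, smul_zero, add_zero, one_val_smul _ hm']
  exact sum_carry _ (fun h => by subst h; simpa using hm')

lemma P_S2 (ζm ζn : A) (hn : n • ζn = 0) (a b d : ℕ) :
    S (P m n ζm ζn a b d) (g2 m n) n (g2 m n) = d • ζn := by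
  have hn' : n • d • ζn = 0 := by rw [smul_comm, hn, smul_zero]
  simp only [S, P, ng2, ZMod.val_zero, zero_smul, smul_zero, add_zero, one_val_smul _ hn',
    Nat.zero_div, zero_add]
  exact sum_carry _ (fun h => by subst h; simpa using hn')

lemma P_Sh1 (ζm ζn : A) (hn : n • ζn = 0) (a b d : ℕ) (hb : b < Nat.gcd m n) :
    Sh (P m n ζm ζn a b d) (g1 m n) (g2 m n) m = b • ζn := by
  have hn' : n • b • ζn = 0 := by rw [smul_comm, hn, smul_zero]
  simp only [Sh, P, ng1, g1, g2, ZMod.val_zero, zero_smul, smul_zero, add_zero,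
    one_val_smul _ hn', Nat.zero_div, zero_add, Nat.div_eq_of_lt (ZMod.val_lt _), sub_zero]
  exact sum_carry _ (fun h => by
    subst h
    have : b = 0 := by simpa using hb
    simp [this])

lemma P_Sh2 (ζm ζn : A) (a b d : ℕ) :
    Sh (P m n ζm ζn a b d) (g2 m n) (g1 m n) n = 0 := by
  simp only [Sh, P, ng2, g1, g2, ZMod.val_zero, zero_smul, smul_zero, add_zero,
    Nat.zero_div, zero_add, Nat.div_eq_of_lt (ZMod.val_lt _), sub_zero, Finset.sum_const_zero]

lemma S_sub {G : Type*} [AddCommGroup G] (Φ Ψ : G → G → G → A) (g : G) (r : ℕ) (x : G) :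
    S (fun x y z => Φ x y z - Ψ x y z) g r x = S Φ g r x - S Ψ g r x := by
  simp [S]

lemma Sh_sub {G : Type*} [AddCommGroup G] (Φ Ψ : G → G → G → A) (g h : G) (r : ℕ) :
    Sh (fun x y z => Φ x y z - Ψ x y z) g h r = Sh Φ g h r - Sh Ψ g h r := by
  simp only [Sh, ← Finset.sum_sub_distrib]
  exact Finset.sum_congr rfl fun _ _ => by abel

lemma S_tor {Φ : ZMod m × ZMod n → ZMod m × ZMod n → ZMod m × ZMod n → A}
    (hc : Coc Φ) (hn : Nor Φ) (g : ZMod m × ZMod n) (r : ℕ) (hr : r • g = 0) :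
    r • S Φ g r g = 0 := by
  have h : ∀ j : ℕ, S Φ g r (j • g) = j • S Φ g r g := by
    intro j
    induction j with
    | zero => simpa using S_zero hn g r
    | succ j ih => rw [succ_nsmul, S_shift hc g r hr, ih, succ_nsmul]
  rw [← h, hr, S_zero hn]

/-- additive main theorem; `tm`, `tn` say that torsion is generated by `ζm`, `ζn`. -/
theorem main_add (hdiv : ∀ x : A, ∃ y, n • y = x) (ζm ζn : A)
    (hm : ∀ t : ℤ, t • ζm = 0 ↔ (m : ℤ) ∣ t) (hn : ∀ t : ℤ, t • ζn = 0 ↔ (n : ℤ) ∣ t)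
    (tm : ∀ x : A, m • x = 0 → ∃ a < m, a • ζm = x)
    (tn : ∀ x : A, n • x = 0 → ∃ a < n, a • ζn = x)
    (Φ : ZMod m × ZMod n → ZMod m × ZMod n → ZMod m × ZMod n → A)
    (hc : Coc Φ) (hnor : Nor Φ) :
    ∃! abd : ℕ × ℕ × ℕ, abd.1 < m ∧ abd.2.1 < Nat.gcd m n ∧ abd.2.2 < n ∧
      ∃ f : ZMod m × ZMod n → ZMod m × ZMod n → A, ∀ x y z,
        Φ x y z - P m n ζm ζn abd.1 abd.2.1 abd.2.2 x y z =
          f y z - f (x + y) z + f x (y + z) - f x y := by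
  have zm : m • ζm = 0 := by simpa using (hm m).2 dvd_rfl
  have zn : n • ζn = 0 := by simpa using (hn n).2 dvd_rfl
  have hgpos : 0 < Nat.gcd m n := Nat.gcd_pos_of_pos_left _ (Nat.pos_of_ne_zero (NeZero.ne m))
  obtain ⟨a, ha, hae⟩ := tm _ (S_tor hc hnor (g1 m n) m mg1)
  obtain ⟨d, hd, hde⟩ := tn _ (S_tor hc hnor (g2 m n) n mg2)
  have hrel := Sh_rel hc (g1 m n) (g2 m n) m n mg1 mg2
  obtain ⟨e, he⟩ := hdiv (- Sh Φ (g2 m n) (g1 m n) n)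
  obtain ⟨b', -, hb'⟩ := tn (Sh Φ (g1 m n) (g2 m n) m - m • e) (by
    rw [smul_sub, smul_comm n m e, he, smul_neg, sub_neg_eq_add, hrel])
  have hbez := Nat.gcd_eq_gcd_ab m n
  have hb'' : (b' : ℤ) = (b' % Nat.gcd m n : ℕ) + (Nat.gcd m n : ℤ) * (b' / Nat.gcd m n : ℕ) := by
    exact_mod_cast (Nat.mod_add_div b' (Nat.gcd m n)).symm
  set b := b' % Nat.gcd m n with hb
  set q := b' / Nat.gcd m n
  have hblt : b < Nat.gcd m n := Nat.mod_lt _ hgpos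
  set e' : A := (Nat.gcdA m n * q : ℤ) • ζn with he'
  have ne' : n • e' = 0 := by rw [he', smul_comm, zn, smul_zero]
  have hbe : b' • ζn = b • ζn + m • e' := by
    rw [he', ← natCast_zsmul ζn b', ← natCast_zsmul ζn b, ← natCast_zsmul _ m, smul_smul,
      ← add_smul, ← sub_eq_zero, ← sub_smul, hn, hb'', hbez]
    exact ⟨Nat.gcdB m n * q, by ring⟩
  refine ⟨(a, b, d), ⟨ha, hblt, hd, ?_⟩, ?_⟩
  · refine split (hc.sub (P_coc ζm ζn zm zn a b d)) ?_ ?_ ?_ (e + e') ?_ ?_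
    · intro x y z h
      beta_reduce
      rw [hnor x y z h, P_nor ζm ζn a b d x y z h, sub_zero]
    · rw [S_sub, P_S1 _ _ zm, hae, sub_self]
    · rw [S_sub, P_S2 _ _ zn, hde, sub_self]
    · rw [Sh_sub, P_Sh1 _ _ zn _ _ _ hblt, smul_add]
      rw [hbe, eq_comm, sub_eq_iff_eq_add] at hb'
      rw [hb']; abel
    · rw [Sh_sub, P_Sh2, smul_add, he, ne']; simp
  · rintro ⟨a', c, d'⟩ ⟨ha', hc', hd', f, hf⟩
    simp only at ha' hc' hd' hf
    have i1 := S_cob f _ hf (g1 m n) m mg1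
    have i2 := S_cob f _ hf (g2 m n) n mg2
    have i3 := Sh_cob f _ hf (g1 m n) (g2 m n) m mg1
    have i4 := Sh_cob f _ hf (g2 m n) (g1 m n) n mg2
    rw [S_sub, P_S1 _ _ zm, ← hae] at i1
    rw [S_sub, P_S2 _ _ zn, ← hde] at i2
    rw [Sh_sub, P_Sh1 _ _ zn _ _ _ hc'] at i3
    rw [Sh_sub, P_Sh2, sub_zero] at i4
    have uniq : ∀ (r : ℕ) (s t : ℕ), s < r → t < r → (r : ℤ) ∣ (s : ℤ) - t → t = s := by
      intro r s t hs ht h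
      have := Int.eq_zero_of_abs_lt_dvd h (by rw [abs_lt]; omega)
      omega
    have j1 : a' = a := by
      refine uniq m a a' ha ha' ((hm _).1 ?_)
      rw [sub_smul, natCast_zsmul, natCast_zsmul, i1]
    have j2 : d' = d := by
      refine uniq n d d' hd hd' ((hn _).1 ?_)
      rw [sub_smul, natCast_zsmul, natCast_zsmul, i2]
    have j3 : c = b := by
      set w := f (g1 m n) (g2 m n) - f (g2 m n) (g1 m n) with hw
      have hw' : f (g2 m n) (g1 m n) - f (g1 m n) (g2 m n) = - w := by rw [hw]; abel
      rw [hw'] at i4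
      obtain ⟨t, -, ht⟩ := tn (w - e) (by
        rw [smul_sub, he, i4]; simp)
      have hk : Sh Φ (g1 m n) (g2 m n) m = b' • ζn + m • e := by rw [hb']; abel
      have h0 : ((b' : ℤ) - c - m * t) • ζn = 0 := by
        rw [sub_smul, sub_smul, mul_smul, natCast_zsmul, natCast_zsmul, natCast_zsmul,
          natCast_zsmul, ht, smul_sub, ← i3, hk]
        abel
      have hdv := (hn _).1 h0
      refine uniq _ b c hblt hc' ?_
      have d1 : ((Nat.gcd m n : ℕ) : ℤ) ∣ (m : ℤ) := by exact_mod_cast Nat.gcd_dvd_left m n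
      have d2 : ((Nat.gcd m n : ℕ) : ℤ) ∣ (n : ℤ) := by exact_mod_cast Nat.gcd_dvd_right m n
      have h3 : (b : ℤ) - c = ((b' : ℤ) - c - m * t) + m * t - (Nat.gcd m n : ℤ) * q := by
        rw [hb'']; ring
      rw [h3]
      exact dvd_sub (dvd_add (d2.trans hdv) (d1.mul_right _)) (dvd_mul_right _ _)
    rw [j1, j2, j3]

end phi
end S10

/-- Each `Φ_{a,b,d}` (`0 ≤ a < m`, `0 ≤ b < gcd(m,n)`, `0 ≤ d < n`) is a
normalized 3-cocycle on `Z_m × Z_n` with values in `kˣ`, and every normalized 3-cocycle on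
`Z_m × Z_n` with values in `kˣ` is cohomologous to `Φ_{a,b,d}` for exactly one triple
`(a,b,d)` in that range. -/
theorem statement10 (k : Type*) [Field k] [IsAlgClosed k] [CharZero k]
    (m n : ℕ) (hm : 0 < m) (hn : 0 < n)
    (ζm ζn : kˣ) (hζm : IsPrimitiveRoot ζm m) (hζn : IsPrimitiveRoot ζn n) :
    (∀ a b d : ℕ, a < m → b < Nat.gcd m n → d < n →
      Is3Cocycle (PhiABD m n ζm ζn a b d) ∧
        IsNormalized3Cochain (PhiABD m n ζm ζn a b d)) ∧
    (∀ Φ : ZMod m × ZMod n → ZMod m × ZMod n → ZMod m × ZMod n → kˣ,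
      Is3Cocycle Φ → IsNormalized3Cochain Φ →
        ∃! abd : ℕ × ℕ × ℕ,
          abd.1 < m ∧ abd.2.1 < Nat.gcd m n ∧ abd.2.2 < n ∧
          ∃ f : ZMod m × ZMod n → ZMod m × ZMod n → kˣ,
            ∀ x y z : ZMod m × ZMod n,
              Φ x y z / PhiABD m n ζm ζn abd.1 abd.2.1 abd.2.2 x y z =
                f y z * (f (x + y) z)⁻¹ * f x (y + z) * (f x y)⁻¹) := by
  have : NeZero m := ⟨hm.ne'⟩
  have : NeZero n := ⟨hn.ne'⟩
  have hP : ∀ a b d x y z, Additive.ofMul (PhiABD m n ζm ζn a b d x y z)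
      = S10.P m n (Additive.ofMul ζm) (Additive.ofMul ζn) a b d x y z := by
    intro a b d x y z
    have hc : ∀ p q r : ℕ, p * q * r = r * (q * p) := fun p q r => by ring
    simp only [PhiABD, S10.P, ofMul_mul, ofMul_pow, smul_smul, hc]
  have hzm : ∀ t : ℤ, t • Additive.ofMul ζm = 0 ↔ (m : ℤ) ∣ t := fun t => by
    rw [← ofMul_zpow, ofMul_eq_zero, hζm.zpow_eq_one_iff_dvd]
  have hzn : ∀ t : ℤ, t • Additive.ofMul ζn = 0 ↔ (n : ℤ) ∣ t := fun t => by
    rw [← ofMul_zpow, ofMul_eq_zero, hζn.zpow_eq_one_iff_dvd]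
  have zm : m • Additive.ofMul ζm = 0 := by simpa using (hzm m).2 dvd_rfl
  have zn : n • Additive.ofMul ζn = 0 := by simpa using (hzn n).2 dvd_rfl
  have tor : ∀ (r : ℕ) (ζ : kˣ), 0 < r → IsPrimitiveRoot ζ r → ∀ x : Additive kˣ, r • x = 0 →
      ∃ a < r, a • Additive.ofMul ζ = x := by
    intro r ζ hr hζ x hx
    have : NeZero r := ⟨hr.ne'⟩
    have hx' : (x.toMul) ^ r = 1 := by
      rw [← toMul_nsmul, hx]; rfl
    have hz : IsPrimitiveRoot (ζ : k) r := IsPrimitiveRoot.coe_units_iff.2 hζ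
    obtain ⟨i, hi, h⟩ := hz.eq_pow_of_pow_eq_one (ξ := (x.toMul : k)) (by
      rw [← Units.val_pow_eq_pow_val, hx']; rfl)
    refine ⟨i, hi, ?_⟩
    rw [← ofMul_pow]
    apply Additive.toMul.injective
    apply Units.ext
    simpa using h
  have hdiv : ∀ x : Additive kˣ, ∃ y, n • y = x := by
    intro x
    obtain ⟨z, hz⟩ := IsAlgClosed.exists_pow_nat_eq (x.toMul : k) hn
    have hz0 : z ≠ 0 := by
      rintro rfl
      rw [zero_pow hn.ne'] at hz
      exact (x.toMul).ne_zero hz.symm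
    refine ⟨Additive.ofMul (Units.mk0 z hz0), ?_⟩
    rw [← ofMul_pow]
    apply Additive.toMul.injective
    apply Units.ext
    simpa using hz
  refine ⟨fun a b d _ _ _ => ⟨?_, ?_⟩, fun Φ hc hnor => ?_⟩
  · intro x y z w
    have h := S10.P_coc _ _ zm zn a b d x y z w
    simp only [← hP] at h
    rw [← ofMul_eq_zero, ← h]
    simp only [ofMul_mul, ofMul_inv, sub_eq_add_neg]
  · intro x y z h
    rw [← ofMul_eq_zero, hP, S10.P_nor _ _ a b d x y z h]
  · have key := S10.main_add hdiv _ _ hzm hzn (tor m ζm hm hζm) (tor n ζn hn hζn)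
      (fun x y z => Additive.ofMul (Φ x y z))
      (fun x y z w => by
        have h := congrArg Additive.ofMul (hc x y z w)
        simpa only [ofMul_mul, ofMul_inv, sub_eq_add_neg, ofMul_one] using h)
      (fun x y z h => by beta_reduce; rw [hnor x y z h, ofMul_one])
    refine (existsUnique_congr fun abd => ?_).1 key
    refine and_congr_right fun _ => and_congr_right fun _ => and_congr_right fun _ => ?_
    constructor
    · rintro ⟨f, hf⟩
      refine ⟨fun x y => (f x y).toMul, fun x y z => ?_⟩
      have h := hf x y z
      rw [← hP] at h
      apply Additive.ofMul.injective
      simpa only [ofMul_mul, ofMul_inv, ofMul_div, ofMul_toMul, sub_eq_add_neg] using h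
    · rintro ⟨f, hf⟩
      refine ⟨fun x y => Additive.ofMul (f x y), fun x y z => ?_⟩
      have h := congrArg Additive.ofMul (hf x y z)
      rw [← hP]
      simpa only [ofMul_mul, ofMul_inv, ofMul_div, ofMul_toMul, sub_eq_add_neg] using h
end

section
/- Let m, n be positive integers. The third cohomology group H^3(Z_m × Z_n, k^*) of the group Z_m × Z_n with coefficients in k^* (trivial action), i.e., the group of 3-cocycles modulo 3-coboundaries, is isomorphic to Z_m × Z_{gcd(m,n)} × Z_n. -/
/-- The coboundary homomorphism sending a 2-cochain `f : G × G → kˣ` to the 3-coboundary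
`(x,y,z) ↦ f(y,z)·f(xy,z)⁻¹·f(x,yz)·f(x,y)⁻¹`; its range is the group of 3-coboundaries. -/
noncomputable def d2hom (m n : ℕ) (k : Type*) [Field k] :
    ((ZMod m × ZMod n) → (ZMod m × ZMod n) → kˣ) →*
      ((ZMod m × ZMod n) → (ZMod m × ZMod n) → (ZMod m × ZMod n) → kˣ) where
  toFun f := fun x y z => f y z * (f (x + y) z)⁻¹ * f x (y + z) * (f x y)⁻¹
  map_one' := by
    funext x y z
    simp
  map_mul' := by
    intro a b
    funext x y z
    simp only [Pi.mul_apply, mul_inv]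
    simp [mul_comm, mul_left_comm, mul_assoc]

/-- The coboundary homomorphism sending a 3-cochain `Φ : G×G×G → kˣ` to the 4-cochain
`(x,y,z,w) ↦ Φ(y,z,w)·Φ(xy,z,w)⁻¹·Φ(x,yz,w)·Φ(x,y,zw)⁻¹·Φ(x,y,z)`;
its kernel is the group of 3-cocycles. -/
noncomputable def d3hom (m n : ℕ) (k : Type*) [Field k] :
    ((ZMod m × ZMod n) → (ZMod m × ZMod n) → (ZMod m × ZMod n) → kˣ) →*
      ((ZMod m × ZMod n) → (ZMod m × ZMod n) → (ZMod m × ZMod n) → (ZMod m × ZMod n) → kˣ)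
    where
  toFun Φ := fun x y z w =>
    Φ y z w * (Φ (x + y) z w)⁻¹ * Φ x (y + z) w * (Φ x y (z + w))⁻¹ * Φ x y z
  map_one' := by
    funext x y z w
    simp
  map_mul' := by
    intro a b
    funext x y z w
    simp only [Pi.mul_apply, mul_inv]
    simp [mul_comm, mul_left_comm, mul_assoc]



namespace H3

/-- A piece of a free resolution, in degrees at most four. -/
structure Res (R X P1 P2 P3 P4 : Type*) [CommRing R]
    [AddCommGroup X] [AddCommGroup P1] [AddCommGroup P2] [AddCommGroup P3] [AddCommGroup P4]
    [Module R X] [Module R P1] [Module R P2] [Module R P3] [Module R P4] where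
  d1 : P1 →ₗ[R] X
  d2 : P2 →ₗ[R] P1
  d3 : P3 →ₗ[R] P2
  d4 : P4 →ₗ[R] P3
  c1 : ∀ x, d1 (d2 x) = 0
  c2 : ∀ x, d2 (d3 x) = 0
  c3 : ∀ x, d3 (d4 x) = 0
  x1 : ∀ x, d1 x = 0 → ∃ y, d2 y = x
  x2 : ∀ x, d2 x = 0 → ∃ y, d3 y = x
  x3 : ∀ x, d3 x = 0 → ∃ y, d4 y = x

theorem lift_exists {R P Y Z : Type*} [CommRing R] [AddCommGroup P] [AddCommGroup Y]
    [AddCommGroup Z] [Module R P] [Module R Y] [Module R Z] [Module.Projective R P]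
    (d : Y →ₗ[R] Z) (f : P →ₗ[R] Z) (h : ∀ p, ∃ y, d y = f p) :
    ∃ g : P →ₗ[R] Y, ∀ p, d (g p) = f p := by
  obtain ⟨g, hg⟩ := Module.projective_lifting_property d.rangeRestrict
    (f.codRestrict (LinearMap.range d) h) d.surjective_rangeRestrict
  refine ⟨g, fun p => ?_⟩
  have := congrArg Subtype.val (LinearMap.congr_fun hg p)
  exact this

section
variable {R X P1 P2 P3 P4 Q1 Q2 Q3 Q4 M : Type*} [CommRing R]
    [AddCommGroup X] [AddCommGroup P1] [AddCommGroup P2] [AddCommGroup P3] [AddCommGroup P4]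
    [Module R X] [Module R P1] [Module R P2] [Module R P3] [Module R P4]
    [AddCommGroup Q1] [AddCommGroup Q2] [AddCommGroup Q3] [AddCommGroup Q4]
    [Module R Q1] [Module R Q2] [Module R Q3] [Module R Q4]
    [AddCommGroup M] [Module R M]

theorem chain_map [Module.Projective R P1] [Module.Projective R P2] [Module.Projective R P3]
    [Module.Projective R P4]
    (A : Res R X P1 P2 P3 P4) (B : Res R X Q1 Q2 Q3 Q4)
    (h : ∀ p, ∃ q, B.d1 q = A.d1 p) :
    ∃ (f1 : P1 →ₗ[R] Q1) (f2 : P2 →ₗ[R] Q2) (f3 : P3 →ₗ[R] Q3) (f4 : P4 →ₗ[R] Q4),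
      (∀ p, B.d1 (f1 p) = A.d1 p) ∧ (∀ p, B.d2 (f2 p) = f1 (A.d2 p)) ∧
      (∀ p, B.d3 (f3 p) = f2 (A.d3 p)) ∧ (∀ p, B.d4 (f4 p) = f3 (A.d4 p)) := by
  obtain ⟨f1, h1⟩ := lift_exists B.d1 A.d1 h
  obtain ⟨f2, h2⟩ := lift_exists B.d2 (f1 ∘ₗ A.d2) (fun p => B.x1 _ (by simp [h1, A.c1]))
  obtain ⟨f3, h3⟩ := lift_exists B.d3 (f2 ∘ₗ A.d3) (fun p => B.x2 _ (by simp [h2, A.c2]))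
  obtain ⟨f4, h4⟩ := lift_exists B.d4 (f3 ∘ₗ A.d4) (fun p => B.x3 _ (by simp [h3, A.c3]))
  exact ⟨f1, f2, f3, f4, h1, h2, h3, h4⟩

theorem homotopy [Module.Projective R P1] [Module.Projective R P2] [Module.Projective R P3]
    (A : Res R X P1 P2 P3 P4) (u1 : P1 →ₗ[R] P1) (u2 : P2 →ₗ[R] P2) (u3 : P3 →ₗ[R] P3)
    (h1 : ∀ p, A.d1 (u1 p) = A.d1 p) (h2 : ∀ p, A.d2 (u2 p) = u1 (A.d2 p))
    (h3 : ∀ p, A.d3 (u3 p) = u2 (A.d3 p)) :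
    ∃ (s2 : P2 →ₗ[R] P3) (s3 : P3 →ₗ[R] P4),
      ∀ p, u3 p = p + A.d4 (s3 p) + s2 (A.d3 p) := by
  obtain ⟨s1, k1⟩ := lift_exists A.d2 (u1 - LinearMap.id) (fun p => A.x1 _ (by simp [h1]))
  obtain ⟨s2, k2⟩ := lift_exists A.d3 (u2 - LinearMap.id - s1 ∘ₗ A.d2)
    (fun p => A.x2 _ (by simp [h2, k1]))
  obtain ⟨s3, k3⟩ := lift_exists A.d4 (u3 - LinearMap.id - s2 ∘ₗ A.d3)
    (fun p => A.x3 _ (by simp [h3, k2, A.c2]))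
  refine ⟨s2, s3, fun p => ?_⟩
  rw [k3]; simp only [LinearMap.sub_apply, LinearMap.comp_apply, LinearMap.id_apply]; abel

/-- comparison of the degree three cohomology of two resolutions -/
theorem comparison [Module.Projective R P1] [Module.Projective R P2] [Module.Projective R P3]
    [Module.Projective R P4] [Module.Projective R Q1] [Module.Projective R Q2]
    [Module.Projective R Q3] [Module.Projective R Q4]
    (A : Res R X P1 P2 P3 P4) (B : Res R X Q1 Q2 Q3 Q4)
    (h : ∀ p, ∃ q, B.d1 q = A.d1 p) (h' : ∀ p, ∃ q, A.d1 q = B.d1 p) :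
    ∃ f3 : P3 →ₗ[R] Q3,
      (∀ φ : Q3 →ₗ[R] M, φ ∘ₗ B.d4 = 0 → (φ ∘ₗ f3) ∘ₗ A.d4 = 0) ∧
      (∀ φ : Q3 →ₗ[R] M, φ ∘ₗ B.d4 = 0 →
        ((∃ ψ : P2 →ₗ[R] M, φ ∘ₗ f3 = ψ ∘ₗ A.d3) ↔ ∃ ψ : Q2 →ₗ[R] M, φ = ψ ∘ₗ B.d3)) ∧
      (∀ χ : P3 →ₗ[R] M, χ ∘ₗ A.d4 = 0 → ∃ φ : Q3 →ₗ[R] M, φ ∘ₗ B.d4 = 0 ∧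
        ∃ ψ : P2 →ₗ[R] M, φ ∘ₗ f3 = χ + ψ ∘ₗ A.d3) := by
  obtain ⟨f1, f2, f3, f4, hf1, hf2, hf3, hf4⟩ := chain_map A B h
  obtain ⟨g1, g2, g3, g4, hg1, hg2, hg3, hg4⟩ := chain_map B A h'
  obtain ⟨s2, s3, hs⟩ := homotopy A (g1 ∘ₗ f1) (g2 ∘ₗ f2) (g3 ∘ₗ f3) (by simp [hf1, hg1])
    (by simp [hf2, hg2]) (by simp [hf3, hg3])
  obtain ⟨r2, r3, hr⟩ := homotopy B (f1 ∘ₗ g1) (f2 ∘ₗ g2) (f3 ∘ₗ g3) (by simp [hf1, hg1])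
    (by simp [hf2, hg2]) (by simp [hf3, hg3])
  refine ⟨f3, fun φ hφ => ?_, fun φ hφ => ⟨?_, ?_⟩, fun χ hχ => ?_⟩
  · ext p
    have := LinearMap.congr_fun hφ (f4 p)
    simpa [hf4] using this
  · rintro ⟨ψ, hψ⟩
    refine ⟨ψ ∘ₗ g2 - φ ∘ₗ r2, ?_⟩
    ext q
    have e1 := congrArg φ (hr q)
    have e2 := LinearMap.congr_fun hφ (r3 q)
    have e3 := LinearMap.congr_fun hψ (g3 q)
    simp only [LinearMap.comp_apply, map_add, LinearMap.zero_apply, LinearMap.sub_apply] at *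
    rw [e2, add_zero] at e1
    rw [← hg3, ← e3, e1]; simp
  · rintro ⟨ψ, rfl⟩
    refine ⟨ψ ∘ₗ f2, ?_⟩
    ext q
    simp [hf3]
  · refine ⟨χ ∘ₗ g3, ?_, χ ∘ₗ s2, ?_⟩
    · ext p
      have := LinearMap.congr_fun hχ (g4 p)
      simpa [hg4] using this
    · ext p
      have e1 := congrArg χ (hs p)
      have e2 := LinearMap.congr_fun hχ (s3 p)
      simp only [LinearMap.comp_apply, map_add, LinearMap.zero_apply, LinearMap.add_apply] at *
      rw [e1, e2]; simp
end

/-- The small resolution, from ring elements with contractions. -/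
theorem small_res (R : Type*) [CommRing R] (s N t T : R) (P L P' L' : R →+ R)
    (hs : s * N = 0) (ht : t * T = 0)
    (a1 : ∀ r, s * P r + L (N * r) = r) (a2 : ∀ r, P (s * r) + N * L r = r)
    (b1 : ∀ r, t * P' r + L' (T * r) = r) (b2 : ∀ r, P' (t * r) + T * L' r = r)
    (cP : ∀ r, P (t * r) = t * P r) (cL : ∀ r, L (t * r) = t * L r) :
    ∃ A : Res R R (R × R) (R × R × R) (R × R × R × R) (R × R × R × R × R),
      (∀ x, A.d1 x = s * x.1 + t * x.2) ∧
      (∀ x, A.d3 x = (s * x.1 + t * x.2.1, N * x.2.1 - T * x.2.2.1, s * x.2.2.1 + t * x.2.2.2)) ∧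
      (∀ x, A.d4 x = (N * x.1 - t * x.2.1, s * x.2.1 + T * x.2.2.1,
        N * x.2.2.1 - t * x.2.2.2.1, s * x.2.2.2.1 + T * x.2.2.2.2)) := by
  have k1 : ∀ r q, s * r = t * q → r = t * P q + N * L r := fun r q h => by
    have := a2 r
    rw [h, cP] at this; exact this.symm
  have k2 : ∀ r q, N * r = t * q → r = s * P r + t * L q := fun r q h => by
    have := a1 r
    rw [h, cL] at this; exact this.symm
  have l1 : ∀ r, t * r = 0 → r = T * L' r := fun r h => by
    have := b2 r
    rw [h, map_zero, zero_add] at this; exact this.symm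
  have l2 : ∀ r, T * r = 0 → r = t * P' r := fun r h => by
    have := b1 r
    rw [h, map_zero, add_zero] at this; exact this.symm
  refine ⟨{
    d1 := ⟨⟨fun x => s * x.1 + t * x.2, ?_⟩, ?_⟩
    d2 := ⟨⟨fun x => (N * x.1 - t * x.2.1, s * x.2.1 + T * x.2.2), ?_⟩, ?_⟩
    d3 := ⟨⟨fun x => (s * x.1 + t * x.2.1, N * x.2.1 - T * x.2.2.1, s * x.2.2.1 + t * x.2.2.2),
      ?_⟩, ?_⟩
    d4 := ⟨⟨fun x => (N * x.1 - t * x.2.1, s * x.2.1 + T * x.2.2.1,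
        N * x.2.2.1 - t * x.2.2.2.1, s * x.2.2.2.1 + T * x.2.2.2.2), ?_⟩, ?_⟩
    c1 := ?_
    c2 := ?_
    c3 := ?_
    x1 := ?_
    x2 := ?_
    x3 := ?_ }, fun _ => rfl, fun _ => rfl, fun _ => rfl⟩
  case refine_1 | refine_2 | refine_3 | refine_4 | refine_5 | refine_6 | refine_7 | refine_8 =>
    intros; simp [mul_add, mul_left_comm] <;> grind
  case refine_9 => rintro ⟨a, b, c⟩; simp; linear_combination a * hs + c * ht
  case refine_10 =>
    rintro ⟨a, b, c, d⟩; simp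
    exact ⟨by linear_combination a * hs + c * ht, by linear_combination b * hs + d * ht⟩
  case refine_11 =>
    rintro ⟨a, b, c, d, e⟩; simp
    exact ⟨by linear_combination a * hs + c * ht, by linear_combination b * hs + d * ht, by linear_combination c * hs + e * ht⟩
  case refine_12 =>
    rintro ⟨a, b⟩ h
    simp only [LinearMap.coe_mk, AddHom.coe_mk, Prod.mk.injEq, Prod.exists] at h ⊢
    have h1 := k1 a (-b) (by linear_combination h)
    have h2 := l1 (b - s * P b) (by
      rw [map_neg] at h1
      linear_combination h - s * h1 - L a * hs)
    exact ⟨L a, P b, L' (b - s * P b), by rw [map_neg] at h1; linear_combination -h1,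
      by linear_combination -h2⟩
  case refine_13 =>
    rintro ⟨a, b, c⟩ h
    simp only [LinearMap.coe_mk, AddHom.coe_mk, Prod.mk.injEq, Prod.exists,
      Prod.mk_eq_zero] at h ⊢
    obtain ⟨h, h'⟩ := h
    have h1 := k2 a b (by linear_combination h)
    have h2 := l1 (b - N * L b) (by
      linear_combination N * h1 - h + P a * hs)
    have h3 := l2 (c + s * L' (b - N * L b)) (by
      linear_combination h' - s * h2 - L b * hs)
    refine ⟨P a, L b, -L' (b - N * L b), P' (c + s * L' (b - N * L b)), ?_, ?_, ?_⟩
    · linear_combination -h1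
    · linear_combination -h2
    · linear_combination -h3
  case refine_14 =>
    rintro ⟨a, b, c, d⟩ h
    simp only [LinearMap.coe_mk, AddHom.coe_mk, Prod.mk.injEq, Prod.exists,
      Prod.mk_eq_zero] at h ⊢
    obtain ⟨h, h', h''⟩ := h
    have h1 := k1 a (-b) (by linear_combination h)
    rw [map_neg] at h1
    have h2 := l1 (b - s * P b) (by linear_combination h - s * h1 - L a * hs)
    set a22 := L' (b - s * P b)
    have h3 := l2 (c - N * a22) (by linear_combination -h' + N * h2 + P b * hs)
    set a13 := P' (c - N * a22)
    have h4 := l1 (d + s * a13) (by linear_combination h'' - s * h3 - a22 * hs)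
    refine ⟨L a, P b, a22, -a13, L' (d + s * a13), ?_, ?_, ?_, ?_⟩
    · linear_combination -h1
    · linear_combination -h2
    · linear_combination -h3
    · linear_combination -h4


open AddMonoidAlgebra

/-- additive map on the group ring with given values on the basis -/
noncomputable def ap {G B : Type*} [AddCommGroup B] (v : G → B) : AddMonoidAlgebra ℤ G →+ B :=
  (Finsupp.linearCombination ℤ v).toAddMonoidHom.comp
    (AddMonoidAlgebra.coeffAddEquiv (R := ℤ) (M := G)).toAddMonoidHom

@[simp] theorem ap_single {G B : Type*} [AddCommGroup B] (v : G → B) (g : G) :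
    ap v (single g 1) = v g := by
  change Finsupp.linearCombination ℤ v (Finsupp.single g 1) = _
  simp

theorem hom_eq {G B : Type*} [AddCommGroup B] (f g : AddMonoidAlgebra ℤ G →+ B)
    (h : ∀ x, f (single x 1) = g (single x 1)) (r : AddMonoidAlgebra ℤ G) : f r = g r := by
  have : f = g := by
    apply AddMonoidAlgebra.addHom_ext'
    intro x
    apply AddMonoidHom.ext_int
    exact h x
  rw [this]

theorem contr (m : ℕ) [NeZero m] (J G : Type*) [AddCommGroup J] [AddCommGroup G]
    (e : ZMod m × J ≃+ G) (s N : AddMonoidAlgebra ℤ G)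
    (hs : s = single (e (1, 0)) 1 - 1) (hN : N = ∑ a : ZMod m, single (e (a, 0)) 1) :
    ∃ P L : AddMonoidAlgebra ℤ G →+ AddMonoidAlgebra ℤ G,
      s * N = 0 ∧ (∀ r, s * P r + L (N * r) = r) ∧ (∀ r, P (s * r) + N * L r = r) ∧
      (∀ j r, P (single (e (0, j)) 1 * r) = single (e (0, j)) 1 * P r) ∧
      (∀ j r, L (single (e (0, j)) 1 * r) = single (e (0, j)) 1 * L r) ∧
      (∀ i j, L (N * single (e (i, j)) 1) = single (e (0, j)) 1) := by
  have hm : m ≠ 0 := NeZero.ne m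
  set P : AddMonoidAlgebra ℤ G →+ AddMonoidAlgebra ℤ G :=
    ap fun g => ∑ l ∈ Finset.range (e.symm g).1.val, single (e ((l : ZMod m), (e.symm g).2)) 1
    with hP
  set L : AddMonoidAlgebra ℤ G →+ AddMonoidAlgebra ℤ G :=
    ap fun g => if (e.symm g).1 + 1 = 0 then single (e (0, (e.symm g).2)) 1 else 0 with hL
  have P1 : ∀ i j, P (single (e (i, j)) 1) =
      ∑ l ∈ Finset.range i.val, single (e ((l : ZMod m), j)) 1 := by
    intro i j; simp [hP]
  have L1 : ∀ i j, L (single (e (i, j)) 1) = if i + 1 = 0 then single (e (0, j)) 1 else 0 := by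
    intro i j; simp [hL]
  have N1 : ∀ i j, N * single (e (i, j)) 1 = ∑ a : ZMod m, single (e (a, j)) 1 := by
    intro i j
    rw [hN, Finset.sum_mul]
    simp only [AddMonoidAlgebra.single_mul_single, ← map_add, Prod.mk_add_mk, zero_add, mul_one]
    exact Fintype.sum_equiv (Equiv.addRight i) _ _ (fun a => by simp)
  have s1 : ∀ i j, s * single (e (i, j)) 1 = single (e (i + 1, j)) 1 - single (e (i, j)) 1 := by
    intro i j
    rw [hs, sub_mul, one_mul, AddMonoidAlgebra.single_mul_single, ← map_add, Prod.mk_add_mk,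
      zero_add, mul_one, add_comm]
  have LN : ∀ i j, L (N * single (e (i, j)) 1) = single (e (0, j)) 1 := by
    intro i j
    rw [N1, map_sum]
    simp only [L1, ← eq_neg_iff_add_eq_zero]
    simp
  refine ⟨P, L, ?_, ?_, ?_, ?_, ?_, LN⟩
  · rw [mul_comm, hs, mul_sub, N1, mul_one, hN, sub_self]
  · refine hom_eq ((AddMonoidHom.mulLeft s).comp P + L.comp (AddMonoidHom.mulLeft N))
      (AddMonoidHom.id _) fun g => ?_
    obtain ⟨⟨i, j⟩, rfl⟩ := e.surjective g
    simp only [AddMonoidHom.add_apply, AddMonoidHom.comp_apply, AddMonoidHom.coe_mulLeft,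
      AddMonoidHom.id_apply, LN, P1, Finset.mul_sum, s1]
    have := Finset.sum_range_sub
      (fun l : ℕ => (single (e ((l : ZMod m), j)) 1 : AddMonoidAlgebra ℤ G)) i.val
    push_cast at this
    rw [this]; simp
  · refine hom_eq (P.comp (AddMonoidHom.mulLeft s) + (AddMonoidHom.mulLeft N).comp L)
      (AddMonoidHom.id _) fun g => ?_
    obtain ⟨⟨i, j⟩, rfl⟩ := e.surjective g
    simp only [AddMonoidHom.add_apply, AddMonoidHom.comp_apply, AddMonoidHom.coe_mulLeft,
      AddMonoidHom.id_apply, L1, P1, s1, map_sub]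
    by_cases h : i + 1 = 0
    · rw [if_pos h, N1, h]
      have hv : i.val + 1 = m := by
        have h2 : ((i.val + 1 : ℕ) : ZMod m) = 0 := by simpa using h
        have h3 := (ZMod.natCast_eq_zero_iff _ _).1 h2
        have := i.val_lt
        exact le_antisymm this (Nat.le_of_dvd (by omega) h3)
      have h4 : ∑ a : ZMod m, (single (e (a, j)) 1 : AddMonoidAlgebra ℤ G) =
          ∑ l ∈ Finset.range m, single (e ((l : ZMod m), j)) 1 := by
        symm
        refine Finset.sum_bij (fun l _ => (l : ZMod m)) (by simp) ?_ ?_ (by simp)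
        · intro a ha b hb hab
          have := congrArg ZMod.val hab
          simpa [ZMod.val_natCast, Nat.mod_eq_of_lt (Finset.mem_range.1 ha),
            Nat.mod_eq_of_lt (Finset.mem_range.1 hb)] using this
        · intro b _
          exact ⟨b.val, by simpa using b.val_lt, by simp⟩
      rw [h4, show Finset.range m = Finset.range (i.val + 1) by rw [hv], Finset.sum_range_succ]
      simp
    · rw [if_neg h]
      have hv : (i + 1).val = i.val + 1 := by
        have hlt : i.val + 1 < m := by
          by_contra hc
          have := i.val_lt
          have h5 : i.val + 1 = m := by omega
          apply h
          have : ((i.val + 1 : ℕ) : ZMod m) = 0 := by rw [h5]; simp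
          simpa using this
        have : ((i.val + 1 : ℕ) : ZMod m) = i + 1 := by simp
        rw [← this, ZMod.val_natCast, Nat.mod_eq_of_lt hlt]
      rw [hv, Finset.sum_range_succ]
      simp
  · intro j0
    refine hom_eq (P.comp (AddMonoidHom.mulLeft (single (e (0, j0)) 1))) ((AddMonoidHom.mulLeft (single (e (0, j0)) 1)).comp P) fun g => ?_
    obtain ⟨⟨i, j⟩, rfl⟩ := e.surjective g
    simp only [AddMonoidHom.comp_apply, AddMonoidHom.coe_mulLeft,
      AddMonoidAlgebra.single_mul_single, ← map_add, Prod.mk_add_mk, zero_add, mul_one, P1,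
      Finset.mul_sum]
  · intro j0
    refine hom_eq (L.comp (AddMonoidHom.mulLeft (single (e (0, j0)) 1))) ((AddMonoidHom.mulLeft (single (e (0, j0)) 1)).comp L) fun g => ?_
    obtain ⟨⟨i, j⟩, rfl⟩ := e.surjective g
    simp only [AddMonoidHom.comp_apply, AddMonoidHom.coe_mulLeft,
      AddMonoidAlgebra.single_mul_single, ← map_add, Prod.mk_add_mk, zero_add, mul_one, L1,
      mul_ite, mul_zero, add_zero]


/-- contraction of the bar resolution -/
noncomputable def con (G α : Type*) [AddCommGroup G] :
    (α →₀ AddMonoidAlgebra ℤ G) →+ ((G × α) →₀ AddMonoidAlgebra ℤ G) :=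
  Finsupp.liftAddHom fun a => ap fun g => Finsupp.single (g, a) (single 0 1)

@[simp] theorem con_single (G α : Type*) [AddCommGroup G] (a : α) (g : G) :
    con G α (Finsupp.single a (single g 1)) = Finsupp.single (g, a) (single 0 1) := by
  simp [con]

theorem hom_eq' {G α B : Type*} [AddCommGroup B] (f g : (α →₀ AddMonoidAlgebra ℤ G) →+ B)
    (h : ∀ a x, f (Finsupp.single a (single x 1)) = g (Finsupp.single a (single x 1)))
    (r : α →₀ AddMonoidAlgebra ℤ G) : f r = g r := by
  have : f = g := by
    apply Finsupp.addHom_ext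
    intro a y
    exact hom_eq (f.comp (Finsupp.singleAddHom a)) (g.comp (Finsupp.singleAddHom a)) (h a) y
  rw [this]

section bar
variable (G : Type*) [AddCommGroup G]

noncomputable def b1 : (G →₀ AddMonoidAlgebra ℤ G) →ₗ[AddMonoidAlgebra ℤ G] AddMonoidAlgebra ℤ G :=
  Finsupp.linearCombination _ fun g => single g 1 - single 0 1

noncomputable def b2 : ((G × G) →₀ AddMonoidAlgebra ℤ G) →ₗ[AddMonoidAlgebra ℤ G]
    (G →₀ AddMonoidAlgebra ℤ G) :=
  Finsupp.linearCombination _ fun p => Finsupp.single p.2 (single p.1 1)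
    - Finsupp.single (p.1 + p.2) (single 0 1) + Finsupp.single p.1 (single 0 1)

noncomputable def b3 : ((G × G × G) →₀ AddMonoidAlgebra ℤ G) →ₗ[AddMonoidAlgebra ℤ G]
    ((G × G) →₀ AddMonoidAlgebra ℤ G) :=
  Finsupp.linearCombination _ fun p => Finsupp.single (p.2.1, p.2.2) (single p.1 1)
    - Finsupp.single (p.1 + p.2.1, p.2.2) (single 0 1)
    + Finsupp.single (p.1, p.2.1 + p.2.2) (single 0 1)
    - Finsupp.single (p.1, p.2.1) (single 0 1)

noncomputable def b4 : ((G × G × G × G) →₀ AddMonoidAlgebra ℤ G) →ₗ[AddMonoidAlgebra ℤ G]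
    ((G × G × G) →₀ AddMonoidAlgebra ℤ G) :=
  Finsupp.linearCombination _ fun p =>
    Finsupp.single (p.2.1, p.2.2.1, p.2.2.2) (single p.1 1)
    - Finsupp.single (p.1 + p.2.1, p.2.2.1, p.2.2.2) (single 0 1)
    + Finsupp.single (p.1, p.2.1 + p.2.2.1, p.2.2.2) (single 0 1)
    - Finsupp.single (p.1, p.2.1, p.2.2.1 + p.2.2.2) (single 0 1)
    + Finsupp.single (p.1, p.2.1, p.2.2.1) (single 0 1)

theorem b1_single (a x : G) : b1 G (Finsupp.single a (single x 1)) =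
    single (x + a) 1 - single x 1 := by
  simp [b1, mul_sub, AddMonoidAlgebra.single_mul_single]

theorem b2_single (a b x : G) : b2 G (Finsupp.single (a, b) (single x 1)) =
    Finsupp.single b (single (x + a) 1) - Finsupp.single (a + b) (single x 1)
      + Finsupp.single a (single x 1) := by
  simp [b2, smul_sub, smul_add, AddMonoidAlgebra.single_mul_single]

theorem b3_single (a b c x : G) : b3 G (Finsupp.single (a, b, c) (single x 1)) =
    Finsupp.single (b, c) (single (x + a) 1) - Finsupp.single (a + b, c) (single x 1)
      + Finsupp.single (a, b + c) (single x 1) - Finsupp.single (a, b) (single x 1) := by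
  simp [b3, smul_sub, smul_add, AddMonoidAlgebra.single_mul_single]

theorem b4_single (a b c d x : G) : b4 G (Finsupp.single (a, b, c, d) (single x 1)) =
    Finsupp.single (b, c, d) (single (x + a) 1) - Finsupp.single (a + b, c, d) (single x 1)
      + Finsupp.single (a, b + c, d) (single x 1) - Finsupp.single (a, b, c + d) (single x 1)
      + Finsupp.single (a, b, c) (single x 1) := by
  simp [b4, smul_sub, smul_add, AddMonoidAlgebra.single_mul_single]

theorem bar_h1 (r : G →₀ AddMonoidAlgebra ℤ G) : b2 G (con G G r)
    + (ap fun g => Finsupp.single g (single 0 1)) (b1 G r) = r := by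
  refine hom_eq' ((b2 G).toAddMonoidHom.comp (con G G)
    + (ap fun g => Finsupp.single g (single 0 1)).comp (b1 G).toAddMonoidHom)
    (AddMonoidHom.id _) ?_ r
  intro a x
  simp [b1_single, b2_single]

theorem bar_h2 (r : (G × G) →₀ AddMonoidAlgebra ℤ G) : b3 G (con G _ r)
    + con G _ (b2 G r) = r := by
  refine hom_eq' ((b3 G).toAddMonoidHom.comp (con G _)
    + (con G _).comp (b2 G).toAddMonoidHom) (AddMonoidHom.id _) ?_ r
  rintro ⟨a, b⟩ x
  simp [b2_single, b3_single]

theorem bar_h3 (r : (G × G × G) →₀ AddMonoidAlgebra ℤ G) : b4 G (con G _ r)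
    + con G _ (b3 G r) = r := by
  refine hom_eq' ((b4 G).toAddMonoidHom.comp (con G _)
    + (con G _).comp (b3 G).toAddMonoidHom) (AddMonoidHom.id _) ?_ r
  rintro ⟨a, b, c⟩ x
  simp [b3_single, b4_single]

/-- the bar resolution -/
noncomputable def bar : Res (AddMonoidAlgebra ℤ G) (AddMonoidAlgebra ℤ G)
    (G →₀ AddMonoidAlgebra ℤ G) ((G × G) →₀ AddMonoidAlgebra ℤ G)
    ((G × G × G) →₀ AddMonoidAlgebra ℤ G) ((G × G × G × G) →₀ AddMonoidAlgebra ℤ G) where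
  d1 := b1 G
  d2 := b2 G
  d3 := b3 G
  d4 := b4 G
  c1 := hom_eq' ((b1 G).toAddMonoidHom.comp (b2 G).toAddMonoidHom) 0 (by
    rintro ⟨a, b⟩ x
    simp [b1_single, b2_single, add_assoc])
  c2 := hom_eq' ((b2 G).toAddMonoidHom.comp (b3 G).toAddMonoidHom) 0 (by
    rintro ⟨a, b, c⟩ x
    simp [b3_single, b2_single, add_assoc]
    abel)
  c3 := hom_eq' ((b3 G).toAddMonoidHom.comp (b4 G).toAddMonoidHom) 0 (by
    rintro ⟨a, b, c, d⟩ x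
    simp [b3_single, b4_single, add_assoc]
    abel)
  x1 x h := ⟨con G _ x, by simpa [h] using bar_h1 G x⟩
  x2 x h := ⟨con G _ x, by simpa [h] using bar_h2 G x⟩
  x3 x h := ⟨con G _ x, by simpa [h] using bar_h3 G x⟩

/-- the augmentation -/
noncomputable def aug : AddMonoidAlgebra ℤ G →+* ℤ := (AddMonoidAlgebra.lift ℤ ℤ G 1).toRingHom

@[simp] theorem aug_single (g : G) : aug G (single g 1) = 1 := by
  simp [aug]

theorem bar_range (r : AddMonoidAlgebra ℤ G) : (∃ y, b1 G y = r) ↔ aug G r = 0 := by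
  constructor
  · rintro ⟨y, rfl⟩
    exact hom_eq' ((aug G).toAddMonoidHom.comp (b1 G).toAddMonoidHom) 0 (by
      intro a x
      simp [b1_single]) y
  · intro h
    refine ⟨ap (fun g => Finsupp.single g (single 0 1)) r, ?_⟩
    have := hom_eq ((b1 G).toAddMonoidHom.comp (ap fun g => Finsupp.single g (single 0 1)))
      (AddMonoidHom.id _ - (Int.castAddHom _).comp (aug G).toAddMonoidHom) (by
        intro x
        simp [b1_single, AddMonoidAlgebra.one_def]) r
    simpa [h] using this

end bar

end H3

namespace H3
open AddMonoidAlgebra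

/-- the group ring -/
abbrev RR (m n : ℕ) := AddMonoidAlgebra ℤ (ZMod m × ZMod n)

theorem small (m n : ℕ) [NeZero m] [NeZero n] :
    ∃ (s N t T : AddMonoidAlgebra ℤ (ZMod m × ZMod n)),
    ∃ A : Res (RR m n) (RR m n) (RR m n × RR m n) (RR m n × RR m n × RR m n)
      (RR m n × RR m n × RR m n × RR m n) (RR m n × RR m n × RR m n × RR m n × RR m n),
      (∀ x, A.d3 x = (s * x.1 + t * x.2.1, N * x.2.1 - T * x.2.2.1, s * x.2.2.1 + t * x.2.2.2)) ∧
      (∀ x, A.d4 x = (N * x.1 - t * x.2.1, s * x.2.1 + T * x.2.2.1,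
        N * x.2.2.1 - t * x.2.2.2.1, s * x.2.2.2.1 + T * x.2.2.2.2)) ∧
      aug _ s = 0 ∧ aug _ t = 0 ∧ aug _ N = m ∧ aug _ T = n ∧
      ∀ r, (∃ y, A.d1 y = r) ↔ aug _ r = 0 := by
  obtain ⟨s, hs⟩ : ∃ s : AddMonoidAlgebra ℤ (ZMod m × ZMod n), s = single (1, 0) 1 - 1 := ⟨_, rfl⟩
  obtain ⟨t, ht⟩ : ∃ s : AddMonoidAlgebra ℤ (ZMod m × ZMod n), s = single (0, 1) 1 - 1 := ⟨_, rfl⟩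
  obtain ⟨N, hN⟩ : ∃ s : AddMonoidAlgebra ℤ (ZMod m × ZMod n),
    s = ∑ a : ZMod m, single (a, 0) 1 := ⟨_, rfl⟩
  obtain ⟨T, hT⟩ : ∃ s : AddMonoidAlgebra ℤ (ZMod m × ZMod n),
    s = ∑ a : ZMod n, single (0, a) 1 := ⟨_, rfl⟩
  obtain ⟨P, L, h1, h2, h3, h4, h5, h6⟩ := contr m (ZMod n) (ZMod m × ZMod n) (AddEquiv.refl _)
    s N hs hN
  obtain ⟨P', L', h1', h2', h3', h4', h5', h6'⟩ := contr n (ZMod m) (ZMod m × ZMod n)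
    AddEquiv.prodComm t T ht hT
  simp only [AddEquiv.refl_apply] at h4 h5 h6
  simp only [AddEquiv.coe_prodComm, Prod.swap_prod_mk] at h6'
  obtain ⟨A, hA1, hA3, hA4⟩ := small_res _ s N t T P L P' L' h1 h1' h2 h3 h2' h3'
    (fun r => by rw [ht, sub_mul, map_sub, h4]; simp [sub_mul])
    (fun r => by rw [ht, sub_mul, map_sub, h5]; simp [sub_mul])
  have es : aug _ s = 0 := by simp [hs]
  have et : aug _ t = 0 := by simp [ht]
  refine ⟨s, N, t, T, A, hA3, hA4, es, et, by simp [hN], by simp [hT], fun r => ⟨?_, ?_⟩⟩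
  · rintro ⟨y, rfl⟩
    simp [hA1, es, et]
  · intro h
    have key := hom_eq ((AddMonoidHom.mulLeft s).comp P
      + ((AddMonoidHom.mulLeft t).comp (P'.comp (L.comp (AddMonoidHom.mulLeft N))))
      + (Int.castAddHom _).comp (aug _).toAddMonoidHom) (AddMonoidHom.id _) (by
        rintro ⟨i, j⟩
        have e1 := h2 (single (i, j) 1)
        have e2 := h2' (single (0, j) 1)
        rw [h6] at e1
        rw [h6'] at e2
        simp only [AddMonoidHom.add_apply, AddMonoidHom.comp_apply, AddMonoidHom.coe_mulLeft,
          AddMonoidHom.id_apply, h6]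
        simp only [RingHom.toAddMonoidHom_eq_coe, AddMonoidHom.coe_coe, aug_single,
          Int.coe_castAddHom, Int.cast_one, AddMonoidAlgebra.one_def]
        rw [add_assoc, Prod.zero_eq_mk, e2, e1]) r
    refine ⟨(P r, P' (L (N * r))), ?_⟩
    rw [hA1]
    simpa [h] using key

theorem cohom (m n : ℕ) [NeZero m] [NeZero n] (M : Type*) [AddCommGroup M] :
    ∃ θ : ((ZMod m × ZMod n) → (ZMod m × ZMod n) → (ZMod m × ZMod n) → M) →+ M × M × M × M,
      (∀ Φ, (∀ x y z w, Φ y z w - Φ (x + y) z w + Φ x (y + z) w - Φ x y (z + w) + Φ x y z = 0) →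
        (m • (θ Φ).1 = 0 ∧ m • (θ Φ).2.2.1 + n • (θ Φ).2.1 = 0 ∧ n • (θ Φ).2.2.2 = 0) ∧
        ((∃ f : (ZMod m × ZMod n) → (ZMod m × ZMod n) → M, ∀ x y z, Φ x y z =
          f y z - f (x + y) z + f x (y + z) - f x y) ↔ ∃ z, θ Φ = (0, m • z, -(n • z), 0))) ∧
      (∀ a b c d : M, m • a = 0 → m • c + n • b = 0 → n • d = 0 → ∃ Φ,
        (∀ x y z w, Φ y z w - Φ (x + y) z w + Φ x (y + z) w - Φ x y (z + w) + Φ x y z = 0) ∧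
        ∃ z, θ Φ = (a, b + m • z, c - n • z, d)) := by
  obtain ⟨s, N, t, T, A, hA3, hA4, es, et, eN, eT, hr⟩ := small m n
  let iM : Module (RR m n) M := Module.compHom M (aug (ZMod m × ZMod n))
  have hsm : ∀ (r : RR m n) (x : M), r • x = aug _ r • x := fun _ _ => rfl
  obtain ⟨f3, p1, p2, p3⟩ := comparison (M := M) A (bar (ZMod m × ZMod n))
    (fun p => (bar_range _ _).2 ((hr _).1 ⟨p, rfl⟩))
    (fun p => (hr _).2 ((bar_range _ _).1 ⟨p, rfl⟩))
  set lc : ((ZMod m × ZMod n) → (ZMod m × ZMod n) → (ZMod m × ZMod n) → M) →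
      (((ZMod m × ZMod n) × (ZMod m × ZMod n) × (ZMod m × ZMod n)) →₀ RR m n) →ₗ[RR m n] M :=
    fun Φ => Finsupp.linearCombination (RR m n) (fun p => Φ p.1 p.2.1 p.2.2) with hlc
  have lc1 : ∀ Φ x y z g, lc Φ (Finsupp.single (x, y, z) (single g 1)) = Φ x y z := by
    intro Φ x y z g
    simp [hlc, hsm]
  have lc_inj : ∀ φ : (((ZMod m × ZMod n) × (ZMod m × ZMod n) × (ZMod m × ZMod n)) →₀ RR m n)
      →ₗ[RR m n] M, ∃ Φ, φ = lc Φ := by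
    intro φ
    refine ⟨fun x y z => φ (Finsupp.single (x, y, z) (single 0 1)), ?_⟩
    apply Finsupp.lhom_ext'
    rintro ⟨x, y, z⟩
    apply LinearMap.ext_ring
    simp only [LinearMap.comp_apply, Finsupp.lsingle_apply, AddMonoidAlgebra.one_def, lc1]
  have lc_add : ∀ Φ Ψ, lc (Φ + Ψ) = lc Φ + lc Ψ := by
    intro Φ Ψ
    apply Finsupp.lhom_ext'
    rintro ⟨x, y, z⟩
    apply LinearMap.ext_ring
    simp only [LinearMap.comp_apply, Finsupp.lsingle_apply, AddMonoidAlgebra.one_def, lc1,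
      LinearMap.add_apply, Pi.add_apply]
  have cocyc : ∀ Φ, (∀ x y z w, Φ y z w - Φ (x + y) z w + Φ x (y + z) w - Φ x y (z + w)
      + Φ x y z = 0) ↔ lc Φ ∘ₗ (bar (ZMod m × ZMod n)).d4 = 0 := by
    intro Φ
    change _ ↔ lc Φ ∘ₗ b4 _ = 0
    constructor
    · intro h
      apply Finsupp.lhom_ext'
      rintro ⟨x, y, z, w⟩
      apply LinearMap.ext_ring
      simp only [LinearMap.comp_apply, Finsupp.lsingle_apply, AddMonoidAlgebra.one_def,
        b4_single, map_add, map_sub, lc1, LinearMap.zero_apply, h]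
    · intro h x y z w
      have := LinearMap.congr_fun h (Finsupp.single (x, y, z, w) (single 0 1))
      simpa only [LinearMap.comp_apply, b4_single, map_add, map_sub, lc1,
        LinearMap.zero_apply] using this
  have cobd : ∀ Φ, (∃ f : (ZMod m × ZMod n) → (ZMod m × ZMod n) → M, ∀ x y z, Φ x y z =
      f y z - f (x + y) z + f x (y + z) - f x y) ↔
      ∃ ψ : (((ZMod m × ZMod n) × (ZMod m × ZMod n)) →₀ RR m n) →ₗ[RR m n] M,
        lc Φ = ψ ∘ₗ (bar (ZMod m × ZMod n)).d3 := by
    intro Φ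
    change _ ↔ ∃ ψ, lc Φ = ψ ∘ₗ b3 _
    constructor
    · rintro ⟨f, hf⟩
      refine ⟨Finsupp.linearCombination (RR m n) (fun p => f p.1 p.2), ?_⟩
      have l2 : ∀ x y g, Finsupp.linearCombination (RR m n) (fun p => f p.1 p.2)
          (Finsupp.single (x, y) (single g 1)) = f x y := by
        intro x y g
        simp [hsm]
      apply Finsupp.lhom_ext'
      rintro ⟨x, y, z⟩
      apply LinearMap.ext_ring
      simp only [LinearMap.comp_apply, Finsupp.lsingle_apply, AddMonoidAlgebra.one_def,
        b3_single, map_add, map_sub, lc1, l2, hf]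
    · rintro ⟨ψ, h⟩
      have sh : ∀ x y g, ψ (Finsupp.single (x, y) (single g 1)) =
          ψ (Finsupp.single (x, y) (single 0 1)) := by
        intro x y g
        have : (Finsupp.single (x, y) (single g 1) :
          ((ZMod m × ZMod n) × (ZMod m × ZMod n)) →₀ RR m n) =
            (single g 1 : RR m n) • Finsupp.single (x, y) (single 0 1) := by
          simp [AddMonoidAlgebra.single_mul_single]
        rw [this, map_smul, hsm, aug_single, one_smul]
      refine ⟨fun x y => ψ (Finsupp.single (x, y) (single 0 1)), fun x y z => ?_⟩
      have := LinearMap.congr_fun h (Finsupp.single (x, y, z) (single 0 1))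
      rw [lc1, LinearMap.comp_apply, b3_single, map_sub, map_add, map_sub,
        sh y z] at this
      exact this
  have qq : ∀ (q : (RR m n × RR m n × RR m n × RR m n) →ₗ[RR m n] M) (a b c d : RR m n),
      q (a, b, c, d) = aug _ a • q (1, 0, 0, 0) + aug _ b • q (0, 1, 0, 0)
        + aug _ c • q (0, 0, 1, 0) + aug _ d • q (0, 0, 0, 1) := by
    intro q a b c d
    simp only [← hsm, ← map_smul, ← map_add]
    simp
  have qext : ∀ (q q' : (RR m n × RR m n × RR m n × RR m n) →ₗ[RR m n] M),
      q (1, 0, 0, 0) = q' (1, 0, 0, 0) → q (0, 1, 0, 0) = q' (0, 1, 0, 0) →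
      q (0, 0, 1, 0) = q' (0, 0, 1, 0) → q (0, 0, 0, 1) = q' (0, 0, 0, 1) → q = q' := by
    intro q q' h1 h2 h3 h4
    apply LinearMap.ext
    rintro ⟨a, b, c, d⟩
    rw [qq q, qq q', h1, h2, h3, h4]
  have qd3 : ∀ q : (RR m n × RR m n × RR m n × RR m n) →ₗ[RR m n] M,
      (∃ ψ : (RR m n × RR m n × RR m n) →ₗ[RR m n] M, q = ψ ∘ₗ A.d3) ↔
      ∃ z, q (1, 0, 0, 0) = 0 ∧ q (0, 1, 0, 0) = m • z ∧ q (0, 0, 1, 0) = -(n • z) ∧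
        q (0, 0, 0, 1) = 0 := by
    intro q
    constructor
    · rintro ⟨ψ, rfl⟩
      have q3 : ∀ a b c, ψ (a, b, c) = aug _ a • ψ (1, 0, 0) + aug _ b • ψ (0, 1, 0)
        + aug _ c • ψ (0, 0, 1) := by
        intro a b c
        simp only [← hsm, ← map_smul, ← map_add]
        simp
      refine ⟨ψ (0, 1, 0), ?_⟩
      simp only [LinearMap.comp_apply, hA3, q3 (_ + _)]
      simp [es, et, eN, eT]
    · rintro ⟨z, h1, h2, h3, h4⟩
      refine ⟨LinearMap.toSpanSingleton (RR m n) M z ∘ₗ LinearMap.fst (RR m n) (RR m n) (RR m n)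
        ∘ₗ LinearMap.snd (RR m n) (RR m n) (RR m n × RR m n), ?_⟩
      apply qext
      · simp [h1, hA3]
      · simp [h2, hA3, hsm, eN]
      · simp [h3, hA3, hsm, eT]
      · simp [h4, hA3]
  have qd4 : ∀ q : (RR m n × RR m n × RR m n × RR m n) →ₗ[RR m n] M,
      q ∘ₗ A.d4 = 0 ↔ m • q (1, 0, 0, 0) = 0 ∧
        m • q (0, 0, 1, 0) + n • q (0, 1, 0, 0) = 0 ∧ n • q (0, 0, 0, 1) = 0 := by
    intro q
    constructor
    · intro h
      have e1 := LinearMap.congr_fun h (1, 0, 0, 0, 0)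
      have e2 := LinearMap.congr_fun h (0, 0, 1, 0, 0)
      have e3 := LinearMap.congr_fun h (0, 0, 0, 0, 1)
      simp only [LinearMap.comp_apply, hA4, qq q (_ - _)] at e1 e2 e3
      simp [eN, eT] at e1 e2 e3
      refine ⟨e1, ?_, e3⟩
      rw [add_comm]; exact e2
    · rintro ⟨h1, h2, h3⟩
      apply LinearMap.ext
      rintro ⟨a, b, c, d, e⟩
      simp only [LinearMap.comp_apply, hA4, qq q (_ - _)]
      simp only [map_sub, map_add, map_mul, es, et, eN, eT, zero_mul, sub_zero, zero_add,
        mul_comm (m : ℤ), mul_comm (n : ℤ), mul_smul, natCast_zsmul, h1, h3, smul_zero,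
        add_zero, LinearMap.zero_apply]
      rw [← smul_add, add_comm, h2, smul_zero]
  refine ⟨AddMonoidHom.mk' (fun Φ => (lc Φ (f3 (1, 0, 0, 0)), lc Φ (f3 (0, 1, 0, 0)),
    lc Φ (f3 (0, 0, 1, 0)), lc Φ (f3 (0, 0, 0, 1)))) (fun Φ Ψ => by
      simp only [lc_add, LinearMap.add_apply, Prod.mk_add_mk]), ?_, ?_⟩
  · intro Φ hΦ
    rw [cocyc] at hΦ
    refine ⟨(qd4 _).1 (p1 _ hΦ), ?_⟩
    rw [cobd, ← p2 _ hΦ, qd3]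
    simp
  · intro a b c d ha hbc hd
    let χ : (RR m n × RR m n × RR m n × RR m n) →ₗ[RR m n] M :=
      (LinearMap.toSpanSingleton (RR m n) M a).coprod
      ((LinearMap.toSpanSingleton (RR m n) M b).coprod
      ((LinearMap.toSpanSingleton (RR m n) M c).coprod
      (LinearMap.toSpanSingleton (RR m n) M d)))
    obtain ⟨φ, hφ, ψ, hψ⟩ := p3 χ ((qd4 χ).2 (by simp [χ, ha, hbc, hd]))
    obtain ⟨Φ, rfl⟩ : ∃ Φ, φ = lc Φ := lc_inj φ
    refine ⟨Φ, (cocyc Φ).2 hφ, ?_⟩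
    obtain ⟨z, h1, h2, h3, h4⟩ := (qd3 _).1 ⟨ψ, rfl⟩
    refine ⟨z, ?_⟩
    have e := LinearMap.congr_fun hψ
    simp only [LinearMap.comp_apply, LinearMap.add_apply] at e h1 h2 h3 h4
    simp only [AddMonoidHom.mk'_apply, e, h1, h2, h3, h4]
    simp [χ, sub_eq_add_neg]
end H3
namespace H3

theorem units_div (k : Type*) [Field k] [IsAlgClosed k] (d : ℕ) (hd : 0 < d) (x : Additive kˣ) :
    ∃ y : Additive kˣ, d • y = x := by
  obtain ⟨z, hz⟩ := IsAlgClosed.exists_pow_nat_eq ((x.toMul : kˣ) : k) hd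
  have hz0 : z ≠ 0 := by
    rintro rfl
    rw [zero_pow hd.ne'] at hz
    exact (x.toMul).ne_zero hz.symm
  refine ⟨Additive.ofMul (Units.mk0 z hz0), ?_⟩
  apply Additive.toMul.injective
  ext
  simpa using hz

theorem roots_equiv (k : Type*) [Field k] [IsAlgClosed k] [CharZero k] (d : ℕ) (hd : 0 < d) :
    Nonempty (rootsOfUnity d k ≃* Multiplicative (ZMod d)) := by
  have : NeZero d := ⟨hd.ne'⟩
  have : NeZero (d : k) := ⟨by exact_mod_cast hd.ne'⟩
  have : IsCyclic (rootsOfUnity d k) := rootsOfUnity.isCyclic k d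
  refine ⟨mulEquivOfCyclicCardEq ?_⟩
  rw [HasEnoughRootsOfUnity.natCard_rootsOfUnity]
  simp

theorem aux1 {M : Type*} [AddCommGroup M] (d m' n' : ℕ) (b c : M) :
    d • (n' • b + m' • c) = (d * m') • c + (d * n') • b := by module

theorem aux2 {M : Type*} [AddCommGroup M] (d m' n' : ℕ) (b c z : M) :
    n' • (b + (d * m') • z) + m' • (c - (d * n') • z) = n' • b + m' • c := by module

theorem aux3 {M : Type*} [AddCommGroup M] (m' n' : ℕ) (a b c e : M) :
    n' • (a + b) + m' • (c + e) = (n' • a + m' • c) + (n' • b + m' • e) := by module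

theorem pair_lemma {M : Type*} [AddCommGroup M] (d m' n' : ℕ) (hc : Nat.Coprime m' n')
    (hdiv : ∀ x : M, ∃ y : M, d • y = x) :
    (∀ b c : M, n' • b + m' • c = 0 ↔ ∃ z : M, b = (d * m') • z ∧ c = -((d * n') • z)) ∧
    (∀ w : M, d • w = 0 → ∃ b c : M, n' • b + m' • c = w ∧ (d * m') • c + (d * n') • b = 0) := by
  obtain ⟨u, v, huv⟩ : ∃ u v : ℤ, u * m' + v * n' = 1 := by
    obtain ⟨u, v, h⟩ := Nat.isCoprime_iff_coprime.2 hc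
    exact ⟨u, v, h⟩
  have one : ∀ x : M, (u * m' + v * n') • x = x := fun x => by rw [huv, one_smul]
  simp only [← natCast_zsmul, Nat.cast_mul] at *
  constructor
  · intro b c
    constructor
    · intro h
      obtain ⟨z, hz⟩ := hdiv (u • b - v • c)
      refine ⟨z, ?_, ?_⟩
      · rw [mul_comm, mul_smul, hz]
        have e : (m' : ℤ) • c = -((n' : ℤ) • b) := by
          rw [eq_neg_iff_add_eq_zero, add_comm]; exact h
        calc b = (u * m' + v * n') • b := (one b).symm
          _ = (m' : ℤ) • (u • b) - v • (-((n' : ℤ) • b)) := by module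
          _ = _ := by rw [← e]; module
      · rw [mul_comm, mul_smul, hz]
        have e : (n' : ℤ) • b = -((m' : ℤ) • c) := by
          rw [eq_neg_iff_add_eq_zero]; exact h
        calc c = (u * m' + v * n') • c := (one c).symm
          _ = -(u • (-((m' : ℤ) • c)) - (n' : ℤ) • (v • c)) := by module
          _ = _ := by rw [← e]; module
    · rintro ⟨z, rfl, rfl⟩
      module
  · intro w hw
    refine ⟨v • w, u • w, ?_, ?_⟩
    · rw [← mul_smul, ← mul_smul, ← add_smul,
        show (n' : ℤ) * v + m' * u = 1 by linarith, one_smul]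
    · calc _ = (m' * u + n' * v : ℤ) • ((d : ℤ) • w) := by module
        _ = 0 := by rw [hw, smul_zero]

end H3

/-- `H³(Z_m × Z_n, kˣ)` (3-cocycles modulo 3-coboundaries, trivial
action) is isomorphic to `Z_m × Z_{gcd(m,n)} × Z_n`. -/
theorem statement11 (k : Type*) [Field k] [IsAlgClosed k] [CharZero k]
    (m n : ℕ) (hm : 0 < m) (hn : 0 < n) :
    Nonempty
      (((d3hom m n k).ker ⧸ ((d2hom m n k).range.subgroupOf (d3hom m n k).ker)) ≃*
        (Multiplicative (ZMod m) × Multiplicative (ZMod (Nat.gcd m n)) ×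
          Multiplicative (ZMod n))) := by
  have : NeZero m := ⟨hm.ne'⟩
  have : NeZero n := ⟨hn.ne'⟩
  obtain ⟨θ, h1, h2⟩ := H3.cohom m n (Additive kˣ)
  obtain ⟨d, hd⟩ : ∃ d, d = Nat.gcd m n := ⟨_, rfl⟩
  have hd0 : 0 < d := hd ▸ Nat.gcd_pos_of_pos_left _ hm
  obtain ⟨m', hm'⟩ : d ∣ m := hd ▸ Nat.gcd_dvd_left m n
  obtain ⟨n', hn'⟩ : d ∣ n := hd ▸ Nat.gcd_dvd_right m n
  have hc : Nat.Coprime m' n' := by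
    have e : d * Nat.gcd m' n' = d * 1 := by
      rw [← Nat.gcd_mul_left, ← hm', ← hn', mul_one, hd]
    exact Nat.eq_of_mul_eq_mul_left hd0 e
  rw [← hd]
  obtain ⟨q1, q2⟩ := H3.pair_lemma (M := Additive kˣ) d m' n' hc (H3.units_div k d hd0)
  rw [← hm', ← hn'] at q1 q2
  let Θ : ((ZMod m × ZMod n) → (ZMod m × ZMod n) → (ZMod m × ZMod n) → kˣ) →
      Additive kˣ × Additive kˣ × Additive kˣ × Additive kˣ :=
    fun Φ => θ (fun x y z => Additive.ofMul (Φ x y z))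
  have Θmul : ∀ Φ Ψ, Θ (Φ * Ψ) = Θ Φ + Θ Ψ := fun Φ Ψ => by
    rw [← map_add]; rfl
  have ker3 : ∀ Φ : (ZMod m × ZMod n) → (ZMod m × ZMod n) → (ZMod m × ZMod n) → kˣ,
      Φ ∈ (d3hom m n k).ker ↔ ∀ x y z w, Additive.ofMul (Φ y z w) - Additive.ofMul (Φ (x + y) z w)
        + Additive.ofMul (Φ x (y + z) w) - Additive.ofMul (Φ x y (z + w))
        + Additive.ofMul (Φ x y z) = 0 := by
    intro Φ
    rw [MonoidHom.mem_ker]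
    constructor
    · intro h x y z w
      have := congrArg Additive.ofMul (congrFun (congrFun (congrFun (congrFun h x) y) z) w)
      simpa [d3hom, sub_eq_add_neg] using this
    · intro h
      funext x y z w
      apply Additive.ofMul.injective
      simpa [d3hom, sub_eq_add_neg] using h x y z w
  have ran2 : ∀ Φ : (ZMod m × ZMod n) → (ZMod m × ZMod n) → (ZMod m × ZMod n) → kˣ,
      Φ ∈ (d2hom m n k).range ↔ ∃ f : (ZMod m × ZMod n) → (ZMod m × ZMod n) → Additive kˣ,
        ∀ x y z, Additive.ofMul (Φ x y z) = f y z - f (x + y) z + f x (y + z) - f x y := by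
    intro Φ
    constructor
    · rintro ⟨f, rfl⟩
      refine ⟨fun x y => Additive.ofMul (f x y), fun x y z => ?_⟩
      simp [d2hom, sub_eq_add_neg]
    · rintro ⟨f, hf⟩
      refine ⟨fun x y => (f x y).toMul, ?_⟩
      funext x y z
      apply Additive.ofMul.injective
      rw [hf]
      simp [d2hom, sub_eq_add_neg]
  let χ : (d3hom m n k).ker →* kˣ × kˣ × kˣ := MonoidHom.mk' (fun Φ =>
    ((Θ Φ.1).1.toMul, (n' • (Θ Φ.1).2.1 + m' • (Θ Φ.1).2.2.1).toMul, (Θ Φ.1).2.2.2.toMul)) (by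
      intro Φ Ψ
      rw [Subgroup.coe_mul, Θmul]
      exact Prod.ext rfl (Prod.ext (congrArg Additive.toMul (H3.aux3 m' n' _ _ _ _)) rfl))
  have hker : χ.ker = (d2hom m n k).range.subgroupOf (d3hom m n k).ker := by
    ext ⟨Φ, hΦ⟩
    rw [Subgroup.mem_subgroupOf, MonoidHom.mem_ker]
    change χ ⟨Φ, hΦ⟩ = 1 ↔ Φ ∈ _
    rw [ran2, (h1 _ ((ker3 Φ).1 hΦ)).2]
    change (((Θ Φ).1.toMul, (n' • (Θ Φ).2.1 + m' • (Θ Φ).2.2.1).toMul, (Θ Φ).2.2.2.toMul) :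
      kˣ × kˣ × kˣ) = 1 ↔ ∃ z, Θ Φ = _
    generalize Θ Φ = w
    obtain ⟨a, b, c, e⟩ := w
    have := q1 b c
    simp only [Prod.mk_eq_one, toMul_eq_one, this, Prod.mk.injEq]
    tauto
  have hran : χ.range = (rootsOfUnity m k).prod ((rootsOfUnity d k).prod (rootsOfUnity n k)) := by
    ext ⟨a, b, c⟩
    simp only [Subgroup.mem_prod, mem_rootsOfUnity, MonoidHom.mem_range]
    constructor
    · rintro ⟨⟨Φ, hΦ⟩, h⟩
      have hh := (h1 _ ((ker3 Φ).1 hΦ)).1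
      change m • (Θ Φ).1 = 0 ∧ m • (Θ Φ).2.2.1 + n • (Θ Φ).2.1 = 0 ∧ n • (Θ Φ).2.2.2 = 0 at hh
      change (((Θ Φ).1.toMul, (n' • (Θ Φ).2.1 + m' • (Θ Φ).2.2.1).toMul, (Θ Φ).2.2.2.toMul) :
        kˣ × kˣ × kˣ) = _ at h
      simp only [Prod.mk.injEq] at h
      obtain ⟨rfl, rfl, rfl⟩ := h
      refine ⟨hh.1, ?_, hh.2.2⟩
      have : d • (n' • (Θ Φ).2.1 + m' • (Θ Φ).2.2.1) = 0 := by
        have e := H3.aux1 d m' n' (Θ Φ).2.1 (Θ Φ).2.2.1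
        rw [← hm', ← hn'] at e
        exact e.trans hh.2.1
      exact this
    · rintro ⟨ha, hb, hc'⟩
      obtain ⟨β, γ, hβ, hγ⟩ := q2 (Additive.ofMul b) hb
      obtain ⟨Φ, hΦ, z, hz⟩ := h2 (Additive.ofMul a) β γ (Additive.ofMul c) ha hγ hc'
      refine ⟨⟨fun x y z => (Φ x y z).toMul, (ker3 _).2 hΦ⟩, ?_⟩
      change (((θ Φ).1.toMul, (n' • (θ Φ).2.1 + m' • (θ Φ).2.2.1).toMul, (θ Φ).2.2.2.toMul) :
        kˣ × kˣ × kˣ) = _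
      rw [hz]
      have e : n' • (β + m • z) + m' • (γ - n • z) = Additive.ofMul b := by
        have e := H3.aux2 d m' n' β γ z
        rw [← hm', ← hn'] at e
        exact e.trans hβ
      simp only [e, toMul_ofMul]
  obtain ⟨e1⟩ := H3.roots_equiv k m hm
  obtain ⟨e2⟩ := H3.roots_equiv k d hd0
  obtain ⟨e3⟩ := H3.roots_equiv k n hn
  exact ⟨(QuotientGroup.quotientMulEquivOfEq hker.symm).trans
    ((QuotientGroup.quotientKerEquivRange χ).trans
    ((MulEquiv.subgroupCongr hran).trans
    ((Subgroup.prodEquiv _ _).trans (e1.prodCongr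
      ((Subgroup.prodEquiv _ _).trans (e2.prodCongr e3))))))⟩
end
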